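/- arXiv:2202.07821 — 2 statements merged into one kernel-verified Lean document; each statement's English description precedes it below -/
import Mathlib

section
/- (Comparison inequality on S⁺_n.) Let p, q ∈ S⁺_n with p ≠ q, let v be a nonzero symmetric n×n matrix, and define γ(t) := exp_p(−t·v/‖v‖_p) for t ≥ 0. Then with κ̂ = 1/√2, for every t ≥ 0: d²(γ(t), q) ≤ d²(p,q) + (sinh(tκ̂)/κ̂)·[ (κ̂·d(p,q)/tanh(κ̂·d(p,q)))·t + 2·⟨v, log_p q⟩_p/‖v‖_p ]. -/
open Matrix Real Filter

namespace SPD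

variable {n : ℕ}

/-- Apply a real function to a symmetric matrix via the spectral calculus
(junk value `0` on non-Hermitian input). -/
noncomputable def mfun (p : Matrix (Fin n) (Fin n) ℝ) (f : ℝ → ℝ) : Matrix (Fin n) (Fin n) ℝ :=
  if hp : p.IsHermitian then hp.cfc f else 0

/-- The positive definite square root. -/
noncomputable def msqrt (p : Matrix (Fin n) (Fin n) ℝ) : Matrix (Fin n) (Fin n) ℝ :=
  mfun p Real.sqrt

/-- The eigenvalues of a symmetric matrix (junk value `0` on non-Hermitian input). -/
noncomputable def eigs (p : Matrix (Fin n) (Fin n) ℝ) : Fin n → ℝ :=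
  if hp : p.IsHermitian then hp.eigenvalues else 0

/-- The Loewner order: `p ≤ q` iff `q - p` is positive semidefinite. -/
def Loewner (p q : Matrix (Fin n) (Fin n) ℝ) : Prop := (q - p).PosSemidef

/-- The Riemannian (trace-metric) distance on positive definite matrices:
`d(p,q) = (∑ i, (ln λ_i(p^{-1/2} q p^{-1/2}))²)^{1/2}`. -/
noncomputable def dR (p q : Matrix (Fin n) (Fin n) ℝ) : ℝ :=
  Real.sqrt (∑ i, (Real.log (eigs ((msqrt p)⁻¹ * q * (msqrt p)⁻¹) i)) ^ 2)

/-- The θ-weighted geometric mean `p #_θ q = p^{1/2} (p^{-1/2} q p^{-1/2})^θ p^{1/2}`. -/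
noncomputable def gmean (θ : ℝ) (p q : Matrix (Fin n) (Fin n) ℝ) : Matrix (Fin n) (Fin n) ℝ :=
  msqrt p * mfun ((msqrt p)⁻¹ * q * (msqrt p)⁻¹) (fun x => x ^ θ) * msqrt p

/-- The singular values of a matrix in decreasing order: `svals M i` is `α_{i+1}(M)`,
so `svals M ⟨0,_⟩ = α₁(M) ≥ … ≥ svals M ⟨n-1,_⟩ = α_n(M)`. -/
noncomputable def svals (M : Matrix (Fin n) (Fin n) ℝ) : Fin n → ℝ := fun i =>
  Real.sqrt ((eigs (Mᵀ * M) ∘ Tuple.sort (eigs (Mᵀ * M))) i.rev)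

/-- The operator (spectral) norm: the largest singular value. -/
noncomputable def opNorm (M : Matrix (Fin n) (Fin n) ℝ) : ℝ :=
  if h : 0 < n then svals M ⟨0, h⟩ else 0

/-- The trace-metric inner product `⟨u,v⟩_p = tr(p⁻¹ u p⁻¹ v)`. -/
noncomputable def minner (p u v : Matrix (Fin n) (Fin n) ℝ) : ℝ :=
  (p⁻¹ * u * p⁻¹ * v).trace

/-- The trace-metric norm `‖v‖_p`. -/
noncomputable def mnorm (p v : Matrix (Fin n) (Fin n) ℝ) : ℝ :=
  Real.sqrt (minner p v v)

/-- The Riemannian exponential `exp_p(v) = p^{1/2} exp(p^{-1/2} v p^{-1/2}) p^{1/2}`. -/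
noncomputable def mexpP (p v : Matrix (Fin n) (Fin n) ℝ) : Matrix (Fin n) (Fin n) ℝ :=
  msqrt p * mfun ((msqrt p)⁻¹ * v * (msqrt p)⁻¹) Real.exp * msqrt p

/-- The Riemannian logarithm `log_p(q) = p^{1/2} log(p^{-1/2} q p^{-1/2}) p^{1/2}`. -/
noncomputable def mlogP (p q : Matrix (Fin n) (Fin n) ℝ) : Matrix (Fin n) (Fin n) ℝ :=
  msqrt p * mfun ((msqrt p)⁻¹ * q * (msqrt p)⁻¹) Real.log * msqrt p

/-- `s` is a subgradient of `f` at `p`:  `f(q) ≥ f(p) + ⟨s, log_p q⟩_p` for all `q ∈ S⁺_n`. -/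
def IsSubgrad (f : Matrix (Fin n) (Fin n) ℝ → ℝ) (p s : Matrix (Fin n) (Fin n) ℝ) : Prop :=
  s.IsHermitian ∧ ∀ q : Matrix (Fin n) (Fin n) ℝ, q.PosDef → f p + minner p s (mlogP p q) ≤ f q

/-- Geodesic convexity of a function on `S⁺_n`. -/
def GConvexFun (f : Matrix (Fin n) (Fin n) ℝ → ℝ) : Prop :=
  ∀ p q : Matrix (Fin n) (Fin n) ℝ, p.PosDef → q.PosDef → ∀ θ ∈ Set.Icc (0:ℝ) 1,
    f (gmean θ p q) ≤ (1 - θ) * f p + θ * f q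

/-- Geodesic convexity of a subset of `S⁺_n`. -/
def GConvexSet (X : Set (Matrix (Fin n) (Fin n) ℝ)) : Prop :=
  ∀ p ∈ X, ∀ q ∈ X, ∀ θ ∈ Set.Icc (0:ℝ) 1, gmean θ p q ∈ X

/-- `κ̂ = 1/√2`, the square root of the absolute value of the curvature lower bound `-1/2`. -/
noncomputable def khat : ℝ := (Real.sqrt 2)⁻¹

/-- The inexact projected subgradient iteration: `p₀ ∈ X`; `v_k = s_k + u_k ≠ 0` with
`s_k ∈ ∂f(p_k)` and symmetric error `u_k`; `p̃_{k+1} = exp_{p_k}(−t_k·v_k/‖v_k‖_{p_k})`;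
and `p_{k+1} ∈ X` is a nearest point of `X` to `p̃_{k+1}` w.r.t. `d`. -/
structure Iter (f : Matrix (Fin n) (Fin n) ℝ → ℝ) (X : Set (Matrix (Fin n) (Fin n) ℝ))
    (p s u : ℕ → Matrix (Fin n) (Fin n) ℝ) (t : ℕ → ℝ) : Prop where
  p0_mem : p 0 ∈ X
  subgrad : ∀ k, IsSubgrad f (p k) (s k)
  u_herm : ∀ k, (u k).IsHermitian
  v_ne : ∀ k, s k + u k ≠ 0
  proj_mem : ∀ k, p (k + 1) ∈ X
  proj_nearest : ∀ k, ∀ q ∈ X,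
    dR (mexpP (p k) (-(t k / mnorm (p k) (s k + u k)) • (s k + u k))) (p (k + 1)) ≤
      dR (mexpP (p k) (-(t k / mnorm (p k) (s k + u k)) • (s k + u k))) q

end SPD

namespace SPD

section Helpers

open scoped Matrix.Norms.L2Operator

lemma ode_comp (κ : ℝ) (hκ : 0 < κ) (y Y1 Y2 : ℝ → ℝ)
    (h1 : ∀ t, HasDerivAt y (Y1 t) t) (h2 : ∀ t, HasDerivAt Y1 (Y2 t) t)
    (h3 : ∀ t, Y2 t ≤ κ ^ 2 * y t) (t : ℝ) (ht : 0 ≤ t) :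
    y t ≤ y 0 * Real.cosh (κ * t) + Y1 0 / κ * Real.sinh (κ * t) := by
  have hE : ∀ c s : ℝ, HasDerivAt (fun s => Real.exp (c * s)) (c * Real.exp (c * s)) s := by
    intro c s
    have := ((hasDerivAt_id s).const_mul c).exp
    simpa [mul_comm] using this
  have hP : Antitone (fun s => Real.exp (-κ * s) * (Y1 s + κ * y s)) := by
    refine antitone_of_hasDerivAt_nonpos (f' := fun s => -κ * Real.exp (-κ * s) * (Y1 s + κ * y s)
      + Real.exp (-κ * s) * (Y2 s + κ * Y1 s)) ?_ ?_
    · intro s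
      exact (hE (-κ) s).mul ((h2 s).add ((h1 s).const_mul κ))
    · intro s
      have := h3 s
      have he := Real.exp_pos (-κ * s)
      have : -κ * Real.exp (-κ * s) * (Y1 s + κ * y s)
        + Real.exp (-κ * s) * (Y2 s + κ * Y1 s) = Real.exp (-κ * s) * (Y2 s - κ^2 * y s) := by ring
      simp only [Pi.zero_apply]
      rw [this]
      exact mul_nonpos_of_nonneg_of_nonpos he.le (by linarith)
  set C := Y1 0 + κ * y 0 with hC
  have hP' : ∀ s, 0 ≤ s → Y1 s + κ * y s ≤ C * Real.exp (κ * s) := by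
    intro s hs
    have h := hP hs
    simp only [mul_zero, Real.exp_zero, one_mul] at h
    have he := Real.exp_pos (κ * s)
    have hee : Real.exp (κ * s) * Real.exp (-κ * s) = 1 := by
      rw [← Real.exp_add]; simp
    calc Y1 s + κ * y s = Real.exp (κ * s) * (Real.exp (-κ * s) * (Y1 s + κ * y s)) := by
          rw [← mul_assoc, hee, one_mul]
      _ ≤ Real.exp (κ * s) * C := mul_le_mul_of_nonneg_left h he.le
      _ = _ := by ring
  have hQ : AntitoneOn (fun s => Real.exp (κ * s) * y s - C / (2 * κ) * Real.exp (2 * κ * s))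
      (Set.Ici 0) := by
    have hd : ∀ s, HasDerivAt (fun s => Real.exp (κ * s) * y s
        - C / (2 * κ) * Real.exp (2 * κ * s))
        (κ * Real.exp (κ * s) * y s + Real.exp (κ * s) * Y1 s
          - C / (2 * κ) * (2 * κ * Real.exp (2 * κ * s))) s := fun s =>
      ((hE κ s).mul (h1 s)).sub ((hE (2 * κ) s).const_mul _)
    refine antitoneOn_of_deriv_nonpos (convex_Ici 0)
      (fun s _ => (hd s).continuousAt.continuousWithinAt)
      (fun s _ => (hd s).differentiableAt.differentiableWithinAt) ?_
    intro s hs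
    rw [interior_Ici] at hs
    rw [(hd s).deriv]
    have h := hP' s (le_of_lt hs)
    have he := Real.exp_pos (κ * s)
    have hee : Real.exp (2 * κ * s) = Real.exp (κ * s) * Real.exp (κ * s) := by
      rw [← Real.exp_add]; ring_nf
    rw [hee]
    have : κ * Real.exp (κ * s) * y s + Real.exp (κ * s) * Y1 s
          - C / (2 * κ) * (2 * κ * (Real.exp (κ * s) * Real.exp (κ * s)))
        = Real.exp (κ * s) * (Y1 s + κ * y s - C * Real.exp (κ * s)) := by
      field_simp; ring
    rw [this]
    exact mul_nonpos_of_nonneg_of_nonpos he.le (by linarith)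
  have h := hQ (Set.mem_Ici.2 le_rfl) (Set.mem_Ici.2 ht) ht
  simp only [mul_zero, Real.exp_zero, one_mul, mul_one] at h
  have he := Real.exp_pos (κ * t)
  have hee : Real.exp (2 * κ * t) = Real.exp (κ * t) * Real.exp (κ * t) := by
    rw [← Real.exp_add]; ring_nf
  have hei : Real.exp (-(κ * t)) * Real.exp (κ * t) = 1 := by
    rw [← Real.exp_add]; simp
  rw [Real.cosh_eq, Real.sinh_eq]
  set E := Real.exp (κ * t)
  set E' := Real.exp (-(κ * t))
  rw [hee] at h
  have hE' : 0 < E' := Real.exp_pos _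
  have h5 := mul_le_mul_of_nonneg_left h hE'.le
  have e1 : E' * (E * y t - C / (2 * κ) * (E * E)) = y t - C / (2 * κ) * E := by
    linear_combination (y t - C / (2 * κ) * E) * hei
  rw [e1, hC] at h5
  have e2 : y 0 * ((E + E') / 2) + Y1 0 / κ * ((E - E') / 2)
     = (Y1 0 + κ * y 0) / (2 * κ) * E + E' * (y 0 - (Y1 0 + κ * y 0) / (2 * κ)) := by
    field_simp; ring
  rw [e2]; linarith

lemma sinh_slope {u v : ℝ} (hu : 0 ≤ u) (huv : u ≤ v) : v * Real.sinh u ≤ u * Real.sinh v := by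
  rcases eq_or_lt_of_le hu with rfl | hu0
  · simp
  have hm : MonotoneOn (fun s => s * Real.cosh s - Real.sinh s) (Set.Ici 0) := by
    have hd : ∀ s, HasDerivAt (fun s => s * Real.cosh s - Real.sinh s)
        (1 * Real.cosh s + s * Real.sinh s - Real.cosh s) s := fun s =>
      ((hasDerivAt_id s).mul (Real.hasDerivAt_cosh s)).sub (Real.hasDerivAt_sinh s)
    refine monotoneOn_of_deriv_nonneg (convex_Ici 0)
      (fun s _ => (hd s).continuousAt.continuousWithinAt)
      (fun s _ => (hd s).differentiableAt.differentiableWithinAt) ?_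
    intro s hs
    rw [interior_Ici] at hs
    rw [(hd s).deriv]
    have := mul_nonneg (le_of_lt hs) (Real.sinh_nonneg_iff.2 (le_of_lt hs))
    linarith
  have hd : ∀ s, HasDerivAt (fun s => u * Real.sinh s - s * Real.sinh u)
      (u * Real.cosh s - 1 * Real.sinh u) s := fun s =>
    ((Real.hasDerivAt_sinh s).const_mul u).sub ((hasDerivAt_id s).mul_const _)
  have hm2 : MonotoneOn (fun s => u * Real.sinh s - s * Real.sinh u) (Set.Ici u) := by
    refine monotoneOn_of_deriv_nonneg (convex_Ici u)
      (fun s _ => (hd s).continuousAt.continuousWithinAt)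
      (fun s _ => (hd s).differentiableAt.differentiableWithinAt) ?_
    intro s hs
    rw [interior_Ici] at hs
    rw [(hd s).deriv]
    have h1 := hm (Set.mem_Ici.2 le_rfl) (Set.mem_Ici.2 hu) hu
    simp at h1
    have h2 : Real.cosh u ≤ Real.cosh s := by
      rw [Real.cosh_le_cosh, abs_of_nonneg hu, abs_of_nonneg (hu.trans (le_of_lt hs))]
      exact le_of_lt hs
    nlinarith
  have := hm2 (Set.mem_Ici.2 le_rfl) (Set.mem_Ici.2 huv) huv
  simp only at this
  linarith

/-- `s ↦ s coth s` is monotone. -/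
lemma coth_mono {u v : ℝ} (hu : 0 < u) (huv : u ≤ v) :
    u * Real.cosh u * Real.sinh v ≤ v * Real.cosh v * Real.sinh u := by
  have hm : MonotoneOn (fun s => Real.sinh s * Real.cosh s - s) (Set.Ici 0) := by
    have hd : ∀ s, HasDerivAt (fun s => Real.sinh s * Real.cosh s - s)
        (Real.cosh s * Real.cosh s + Real.sinh s * Real.sinh s - 1) s := fun s =>
      ((Real.hasDerivAt_sinh s).mul (Real.hasDerivAt_cosh s)).sub (hasDerivAt_id s)
    refine monotoneOn_of_deriv_nonneg (convex_Ici 0)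
      (fun s _ => (hd s).continuousAt.continuousWithinAt)
      (fun s _ => (hd s).differentiableAt.differentiableWithinAt) ?_
    intro s hs
    rw [(hd s).deriv]
    nlinarith [Real.one_le_cosh s, mul_self_nonneg (Real.sinh s)]
  have hd : ∀ s, Real.sinh s ≠ 0 → HasDerivAt (fun s => s * Real.cosh s / Real.sinh s)
      (((1 * Real.cosh s + s * Real.sinh s) * Real.sinh s - s * Real.cosh s * Real.cosh s)
        / Real.sinh s ^ 2) s := fun s hs =>
    ((hasDerivAt_id s).mul (Real.hasDerivAt_cosh s)).div (Real.hasDerivAt_sinh s) hs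
  have hne : ∀ s ∈ Set.Ioi (0:ℝ), Real.sinh s ≠ 0 := fun s hs =>
    (Real.sinh_pos_iff.2 hs).ne'
  have hm2 : MonotoneOn (fun s => s * Real.cosh s / Real.sinh s) (Set.Ioi 0) := by
    refine monotoneOn_of_deriv_nonneg (convex_Ioi 0)
      (fun s hs => (hd s (hne s hs)).continuousAt.continuousWithinAt)
      (fun s hs => (hd s (hne s (interior_subset hs))).differentiableAt.differentiableWithinAt) ?_
    intro s hs
    have hs := interior_subset hs
    rw [(hd s (hne s hs)).deriv]
    apply div_nonneg _ (sq_nonneg _)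
    have h1 := hm (Set.mem_Ici.2 le_rfl) (Set.mem_Ici.2 (le_of_lt hs)) (le_of_lt hs)
    simp at h1
    have h2 := Real.cosh_sq s
    have : (1 * Real.cosh s + s * Real.sinh s) * Real.sinh s - s * Real.cosh s * Real.cosh s
      = Real.sinh s * Real.cosh s - s * (Real.cosh s ^ 2 - Real.sinh s ^ 2) := by ring
    rw [this, h2]; linarith
  have h := hm2 (Set.mem_Ioi.2 hu) (Set.mem_Ioi.2 (hu.trans_le huv)) huv
  simp only at h
  rwa [div_le_div_iff₀ (Real.sinh_pos_iff.2 hu) (Real.sinh_pos_iff.2 (hu.trans_le huv))] at h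

lemma sinh_le_mul_cosh {u : ℝ} (hu : 0 ≤ u) : Real.sinh u ≤ u * Real.cosh u := by
  have hm : MonotoneOn (fun s => s * Real.cosh s - Real.sinh s) (Set.Ici 0) := by
    have hd : ∀ s, HasDerivAt (fun s => s * Real.cosh s - Real.sinh s)
        (1 * Real.cosh s + s * Real.sinh s - Real.cosh s) s := fun s =>
      ((hasDerivAt_id s).mul (Real.hasDerivAt_cosh s)).sub (Real.hasDerivAt_sinh s)
    refine monotoneOn_of_deriv_nonneg (convex_Ici 0)
      (fun s _ => (hd s).continuousAt.continuousWithinAt)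
      (fun s _ => (hd s).differentiableAt.differentiableWithinAt) ?_
    intro s hs
    rw [interior_Ici] at hs
    rw [(hd s).deriv]
    have := mul_nonneg (le_of_lt hs) (Real.sinh_nonneg_iff.2 (le_of_lt hs))
    linarith
  have h1 := hm (Set.mem_Ici.2 le_rfl) (Set.mem_Ici.2 hu) hu
  simp at h1
  exact h1

lemma cosh_sub_one_le {u : ℝ} (hu : 0 ≤ u) : 2 * (Real.cosh u - 1) ≤ u * Real.sinh u := by
  have h := sinh_le_mul_cosh (u := u / 2) (by linarith)
  have h0 := Real.sinh_nonneg_iff.2 (show 0 ≤ u / 2 by linarith)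
  have e : u = 2 * (u / 2) := by ring
  have e1 : Real.cosh u = 2 * Real.sinh (u/2) ^ 2 + 1 := by
    conv_lhs => rw [e]
    rw [Real.cosh_two_mul, Real.cosh_sq]; ring
  have e2 : Real.sinh u = 2 * Real.sinh (u/2) * Real.cosh (u/2) := by
    conv_lhs => rw [e]
    rw [Real.sinh_two_mul]
  rw [e1, e2]
  nlinarith

lemma sq_le_tangent {u v : ℝ} (hu : 0 ≤ u) (hv : 0 < v) :
    Real.sinh v * (u ^ 2 - v ^ 2) ≤ 2 * v * (Real.cosh u - Real.cosh v) := by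
  set g : ℝ → ℝ := fun s => 2 * v * Real.cosh s - Real.sinh v * s ^ 2 with hg
  have hd : ∀ s, HasDerivAt g (2 * v * Real.sinh s - Real.sinh v * (2 * s)) s := fun s => by
    have := ((Real.hasDerivAt_cosh s).const_mul (2 * v)).sub
      ((hasDerivAt_pow 2 s).const_mul (Real.sinh v))
    have e : (2 * v * Real.sinh s - Real.sinh v * (2 * s))
      = 2 * v * Real.sinh s - Real.sinh v * (((2 : ℕ) : ℝ) * s ^ (2 - 1)) := by norm_num
    rw [e]
    exact this
  suffices g v ≤ g u by simp only [hg] at this; linarith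
  rcases le_total u v with h | h
  · have : AntitoneOn g (Set.Icc 0 v) := by
      refine antitoneOn_of_deriv_nonpos (convex_Icc 0 v)
        (fun s _ => (hd s).continuousAt.continuousWithinAt)
        (fun s _ => (hd s).differentiableAt.differentiableWithinAt) ?_
      intro s hs
      have hs := interior_subset hs
      rw [(hd s).deriv]
      have := sinh_slope hs.1 hs.2
      linarith
    exact this ⟨hu, h⟩ ⟨hv.le, le_rfl⟩ h
  · have : MonotoneOn g (Set.Ici v) := by
      refine monotoneOn_of_deriv_nonneg (convex_Ici v)
        (fun s _ => (hd s).continuousAt.continuousWithinAt)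
        (fun s _ => (hd s).differentiableAt.differentiableWithinAt) ?_
      intro s hs
      have hs := interior_subset hs
      rw [(hd s).deriv]
      have := sinh_slope hv.le hs
      linarith
    exact this (Set.mem_Ici.2 le_rfl) (Set.mem_Ici.2 h) h

/-- Scalar form of the comparison argument, with regularisation `δ`. -/
lemma scalar_comp (κ : ℝ) (hκ : 0 < κ) (δ : ℝ) (hδ : 0 < δ) (F G G1 : ℝ → ℝ)
    (hF : ∀ t, 0 ≤ F t)
    (h1 : ∀ t, HasDerivAt F (2 * G t) t) (h2 : ∀ t, HasDerivAt G (G1 t) t)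
    (h3 : ∀ t D K, 0 < D → F t ≤ D ^ 2 →
      K = κ * D * Real.cosh (κ * D) / Real.sinh (κ * D) →
      G1 t ≤ K - (K - 1) * (G t ^ 2 / D ^ 2)) (t : ℝ) (ht : 0 ≤ t) :
    F t ≤ F 0 + Real.sinh (t * κ) / κ *
      (κ * √(F 0 + δ) / Real.tanh (κ * √(F 0 + δ)) * t + 2 * G 0) := by
  set D : ℝ → ℝ := fun s => √(F s + δ) with hD
  have hDpos : ∀ s, 0 < D s := fun s => Real.sqrt_pos.2 (by have := hF s; linarith)
  have hDsq : ∀ s, D s ^ 2 = F s + δ := fun s => Real.sq_sqrt (by have := hF s; linarith)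
  have hDd : ∀ s, HasDerivAt D (G s / D s) s := by
    intro s
    have := ((h1 s).add_const δ).sqrt (by have := hF s; linarith)
    convert this using 1
    have := (hDpos s).ne'
    simp only [hD] at this ⊢
    field_simp
  have hch : ∀ s, HasDerivAt (fun s => Real.cosh (κ * D s))
      (κ * Real.sinh (κ * D s) * G s / D s) s := by
    intro s
    have := ((hDd s).const_mul κ).cosh
    convert this using 1; ring
  have hsh : ∀ s, HasDerivAt (fun s => Real.sinh (κ * D s))
      (κ * Real.cosh (κ * D s) * G s / D s) s := by
    intro s
    have := ((hDd s).const_mul κ).sinh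
    convert this using 1; ring
  have hY1 : ∀ s, HasDerivAt (fun s => κ * Real.sinh (κ * D s) * G s / D s)
      (((κ * (κ * Real.cosh (κ * D s) * G s / D s) * G s + κ * Real.sinh (κ * D s) * G1 s) * D s
        - κ * Real.sinh (κ * D s) * G s * (G s / D s)) / D s ^ 2) s := by
    intro s
    exact (((hsh s).const_mul κ).mul (h2 s)).div (hDd s) (hDpos s).ne'
  have hmain := ode_comp κ hκ _ _ _ hch hY1 (by
    intro s
    have hd := hDpos s
    have hs : 0 < Real.sinh (κ * D s) := Real.sinh_pos_iff.2 (mul_pos hκ hd)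
    have hk := h3 s (D s) _ hd (by rw [hDsq]; linarith) rfl
    set sh := Real.sinh (κ * D s)
    set ch := Real.cosh (κ * D s)
    set d := D s
    have e : ((κ * (κ * ch * G s / d) * G s + κ * sh * G1 s) * d - κ * sh * G s * (G s / d)) / d ^ 2
      = κ ^ 2 * ch * (G s ^ 2 / d ^ 2) + κ * sh / d * (G1 s - G s ^ 2 / d ^ 2) := by
      field_simp
      ring
    rw [e]
    have hpos : 0 < κ * sh / d := by positivity
    have := mul_le_mul_of_nonneg_left hk hpos.le
    have e2 : κ * sh / d * (κ * d * ch / sh - (κ * d * ch / sh - 1) * (G s ^ 2 / d ^ 2))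
      = κ ^ 2 * ch - κ ^ 2 * ch * (G s ^ 2 / d ^ 2) + κ * sh / d * (G s ^ 2 / d ^ 2) := by
      field_simp
      ring
    rw [e2] at this
    linarith) t ht
  have hd0 := hDpos 0
  have htan := sq_le_tangent (u := κ * D t) (v := κ * D 0) (mul_pos hκ (hDpos t)).le (mul_pos hκ hd0)
  have hs0 : 0 < Real.sinh (κ * D 0) := Real.sinh_pos_iff.2 (mul_pos hκ hd0)
  have hc := cosh_sub_one_le (mul_nonneg hκ.le ht)
  have hch0 : 0 < Real.cosh (κ * D 0) := Real.cosh_pos _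
  rw [mul_pow, mul_pow, hDsq, hDsq] at htan
  change F t ≤ F 0 + Real.sinh (t * κ) / κ * (κ * D 0 / Real.tanh (κ * D 0) * t + 2 * G 0)
  rw [Real.tanh_eq_sinh_div_cosh, mul_comm t κ]
  set sh := Real.sinh (κ * D 0)
  set ch := Real.cosh (κ * D 0)
  set d := D 0
  set st := Real.sinh (κ * t)
  set ct := Real.cosh (κ * t)
  have h6 : sh * (κ ^ 2 * (F t - F 0)) ≤ 2 * (κ * d) * (ch * (ct - 1) + κ * sh * G 0 / d / κ * st) := by
    have : 2 * (κ * d) * (Real.cosh (κ * D t) - ch) ≤ 2 * (κ * d) * (ch * (ct - 1) + κ * sh * G 0 / d / κ * st) := by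
      apply mul_le_mul_of_nonneg_left _ (by positivity)
      linarith
    linarith
  have h7 : 2 * (κ * d) * (ch * (ct - 1) + κ * sh * G 0 / d / κ * st) ≤
      (κ * d) * ch * (κ * t * st) + 2 * κ * sh * G 0 * st := by
    have e : 2 * (κ * d) * (ch * (ct - 1) + κ * sh * G 0 / d / κ * st) =
      (κ * d) * ch * (2 * (ct - 1)) + 2 * κ * sh * G 0 * st := by field_simp
    rw [e]
    have := mul_le_mul_of_nonneg_left hc (show 0 ≤ κ * d * ch by positivity)
    linarith
  have h8 : sh * (κ ^ 2 * (F t - F 0)) ≤ sh * (κ ^ 2 * (st / κ * (κ * d / (sh / ch) * t + 2 * G 0))) := by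
    refine (h6.trans h7).trans (le_of_eq ?_)
    field_simp
  have h9 := le_of_mul_le_mul_left (le_of_mul_le_mul_left h8 hs0) (by positivity : 0 < κ ^ 2)
  linarith

lemma scalar_comp0 (κ : ℝ) (hκ : 0 < κ) (F G G1 : ℝ → ℝ)
    (hF : ∀ t, 0 ≤ F t) (hF0 : 0 < F 0)
    (h1 : ∀ t, HasDerivAt F (2 * G t) t) (h2 : ∀ t, HasDerivAt G (G1 t) t)
    (h3 : ∀ t D K, 0 < D → F t ≤ D ^ 2 →
      K = κ * D * Real.cosh (κ * D) / Real.sinh (κ * D) →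
      G1 t ≤ K - (K - 1) * (G t ^ 2 / D ^ 2)) (t : ℝ) (ht : 0 ≤ t) :
    F t ≤ F 0 + Real.sinh (t * κ) / κ *
      (κ * √(F 0) / Real.tanh (κ * √(F 0)) * t + 2 * G 0) := by
  set f : ℝ → ℝ := fun δ => F 0 + Real.sinh (t * κ) / κ *
      (κ * √(F 0 + δ) / Real.tanh (κ * √(F 0 + δ)) * t + 2 * G 0) with hf
  have hc : ContinuousAt f 0 := by
    have hne : Real.tanh (κ * √(F 0 + 0)) ≠ 0 := by
      rw [Real.tanh_eq_sinh_div_cosh]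
      have : 0 < κ * √(F 0 + 0) := by rw [add_zero]; exact mul_pos hκ (Real.sqrt_pos.2 hF0)
      exact div_ne_zero (Real.sinh_pos_iff.2 this).ne' (Real.cosh_pos _).ne'
    have hth : Continuous Real.tanh := by
      have : Real.tanh = fun x => Real.sinh x / Real.cosh x := funext Real.tanh_eq_sinh_div_cosh
      rw [this]
      exact Real.continuous_sinh.div Real.continuous_cosh (fun x => (Real.cosh_pos x).ne')
    have hq : Continuous (fun δ => κ * √(F 0 + δ)) := by fun_prop
    have := (hq.continuousAt (x := 0)).div ((hth.comp hq).continuousAt (x := 0)) hne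
    exact continuousAt_const.add (continuousAt_const.mul
      ((this.mul continuousAt_const).add continuousAt_const))
  have h0 : f 0 = F 0 + Real.sinh (t * κ) / κ *
      (κ * √(F 0) / Real.tanh (κ * √(F 0)) * t + 2 * G 0) := by simp [hf]
  rw [← h0]
  have ht' : Tendsto f (nhdsWithin 0 (Set.Ioi 0)) (nhds (f 0)) := hc.tendsto.mono_left nhdsWithin_le_nhds
  refine ge_of_tendsto ht' ?_
  filter_upwards [self_mem_nhdsWithin] with δ hδ
  exact scalar_comp κ hκ δ hδ F G G1 hF h1 h2 h3 t ht


lemma spec {n : ℕ} {B : Matrix (Fin n) (Fin n) ℝ} (hB : B.IsHermitian) :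
    ∃ U : Matrix (Fin n) (Fin n) ℝ, Uᵀ * U = 1 ∧ U * Uᵀ = 1 ∧
      B = U * diagonal (eigs B) * Uᵀ ∧
      ∀ f : ℝ → ℝ, mfun B f = U * diagonal (f ∘ eigs B) * Uᵀ := by
  have h1 : eigs B = hB.eigenvalues := by rw [eigs, dif_pos hB]
  have hst : star (hB.eigenvectorUnitary : Matrix (Fin n) (Fin n) ℝ)
      = (hB.eigenvectorUnitary : Matrix (Fin n) (Fin n) ℝ)ᵀ := by
    rw [star_eq_conjTranspose, conjTranspose_eq_transpose_of_trivial]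
  refine ⟨hB.eigenvectorUnitary, ?_, ?_, ?_, ?_⟩
  · rw [← hst]; exact Unitary.coe_star_mul_self _
  · rw [← hst]; exact Unitary.coe_mul_star_self _
  · rw [h1, ← hst]
    conv_lhs => rw [hB.spectral_theorem]
    rw [Unitary.conjStarAlgAut_apply]
    rfl
  · intro f
    rw [h1, ← hst]
    simp only [mfun, hB, dif_pos, IsHermitian.cfc]
    rw [Unitary.conjStarAlgAut_apply]
    rfl

lemma norm_orth_le {n : ℕ} [Nonempty (Fin n)] {U : Matrix (Fin n) (Fin n) ℝ}
    (hU : Uᵀ * U = 1) : ‖U‖ ≤ 1 := by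
  have h := Matrix.l2_opNorm_conjTranspose_mul_self U
  rw [conjTranspose_eq_transpose_of_trivial, hU] at h
  have h1 : ‖(1 : Matrix (Fin n) (Fin n) ℝ)‖ = 1 := norm_one
  rw [h1] at h
  nlinarith [norm_nonneg U]

lemma norm_conj_le {n : ℕ} [Nonempty (Fin n)] {U B : Matrix (Fin n) (Fin n) ℝ}
    (hU : Uᵀ * U = 1) (hU' : U * Uᵀ = 1) : ‖U * B * Uᵀ‖ ≤ ‖B‖ := by
  have h1 := norm_orth_le hU
  have h2 : ‖Uᵀ‖ ≤ 1 := norm_orth_le (by simpa using hU')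
  calc ‖U * B * Uᵀ‖ ≤ ‖U‖ * ‖B‖ * ‖Uᵀ‖ :=
        (norm_mul_le _ _).trans (mul_le_mul_of_nonneg_right (norm_mul_le _ _) (norm_nonneg _))
    _ ≤ 1 * ‖B‖ * 1 := by gcongr
    _ = ‖B‖ := by ring

lemma conj_inv {n : ℕ} {U B D : Matrix (Fin n) (Fin n) ℝ}
    (hU : Uᵀ * U = 1) (h : B = U * D * Uᵀ) : Uᵀ * B * U = D := by
  rw [h]
  calc Uᵀ * (U * D * Uᵀ) * U = (Uᵀ * U) * D * (Uᵀ * U) := by simp only [Matrix.mul_assoc]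
    _ = D := by rw [hU]; simp

lemma conj_pow' {n : ℕ} {U D : Matrix (Fin n) (Fin n) ℝ}
    (hU : Uᵀ * U = 1) (hU' : U * Uᵀ = 1) (k : ℕ) : (U * D * Uᵀ) ^ k = U * D ^ k * Uᵀ := by
  induction k with
  | zero => simp [hU']
  | succ k ih =>
    rw [pow_succ, ih, pow_succ]
    calc U * D ^ k * Uᵀ * (U * D * Uᵀ) = U * D ^ k * (Uᵀ * U) * D * Uᵀ := by
          simp only [Matrix.mul_assoc]
      _ = _ := by rw [hU]; simp [Matrix.mul_assoc]

/-- divided difference of the logarithm -/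
noncomputable def lam (a b : ℝ) : ℝ := if a = b then a⁻¹ else (Real.log a - Real.log b) / (a - b)

lemma lam_hasSum {c a b : ℝ} (hc : 0 < c) (ha : |1 - a / c| < 1) (hb : |1 - b / c| < 1) :
    HasSum (fun k : ℕ => (1 / ((k : ℝ) + 1)) *
      ∑ l ∈ Finset.range (k + 1), (1 - a / c) ^ (k - l) * (1 - b / c) ^ l) (c * lam a b) := by
  have pos : ∀ {x : ℝ}, |1 - x / c| < 1 → 0 < x := by
    intro x hx
    have := (abs_lt.1 hx).2
    have : 0 < x / c := by linarith
    exact (div_pos_iff_of_pos_right hc).1 this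
  have ha0 := pos ha
  have hb0 := pos hb
  unfold lam
  split_ifs with h
  · subst h
    have h := hasSum_geometric_of_abs_lt_one ha
    convert h using 1
    · funext k
      have : ∑ l ∈ Finset.range (k + 1), (1 - a / c) ^ (k - l) * (1 - a / c) ^ l
          = ∑ l ∈ Finset.range (k + 1), (1 - a / c) ^ k := by
        apply Finset.sum_congr rfl
        intro l hl
        rw [← pow_add]
        congr 1
        have := Finset.mem_range.1 hl
        omega
      rw [this]
      simp
      field_simp
    · have e : 1 - (1 - a / c) = a / c := by ring
      rw [e, inv_div]; ring
  · have h1 := Real.hasSum_pow_div_log_of_abs_lt_one ha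
    have h2 := Real.hasSum_pow_div_log_of_abs_lt_one hb
    have hne : (1 - a / c) - (1 - b / c) ≠ 0 := by
      intro h0
      apply h
      have : a / c = b / c := by linarith
      field_simp at this
      exact this
    have h3 := (h1.sub h2).mul_right ((1 - a / c) - (1 - b / c))⁻¹
    convert! h3 using 1
    · funext k
      have := (Commute.all (1 - b / c) (1 - a / c)).geom_sum₂_mul (k + 1)
      have h4 : ∑ l ∈ Finset.range (k + 1), (1 - a / c) ^ (k - l) * (1 - b / c) ^ l
         = ((1 - a / c) ^ (k + 1) - (1 - b / c) ^ (k + 1)) * ((1 - a / c) - (1 - b / c))⁻¹ := by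
        rw [eq_mul_inv_iff_mul_eq₀ hne]
        have e : ∑ l ∈ Finset.range (k + 1), (1 - a / c) ^ (k - l) * (1 - b / c) ^ l
          = ∑ i ∈ Finset.range (k + 1), (1 - b / c) ^ i * (1 - a / c) ^ (k + 1 - 1 - i) := by
          apply Finset.sum_congr rfl
          intro l hl
          rw [mul_comm]; simp
        rw [e]
        linarith
      rw [h4]
      ring
    · have e1 : Real.log (1 - (1 - a / c)) = Real.log a - Real.log c := by
        rw [← Real.log_div ha0.ne' hc.ne']; congr 1; ring
      have e2 : Real.log (1 - (1 - b / c)) = Real.log b - Real.log c := by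
        rw [← Real.log_div hb0.ne' hc.ne']; congr 1; ring
      rw [e1, e2]
      have e3 : (1 - a / c) - (1 - b / c) = -((a - b) / c) := by ring
      rw [e3]
      have : a - b ≠ 0 := sub_ne_zero.2 h
      field_simp
      ring

lemma mlog_hasSum {n : ℕ} [Nonempty (Fin n)] {B : Matrix (Fin n) (Fin n) ℝ} (hB : B.IsHermitian)
    {c : ℝ} (hc : 0 < c) (h : ‖1 - c⁻¹ • B‖ < 1) :
    HasSum (fun k : ℕ => (1 / ((k : ℝ) + 1)) • (1 - c⁻¹ • B) ^ (k + 1))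
      ((Real.log c) • (1 : Matrix (Fin n) (Fin n) ℝ) - mfun B Real.log) := by
  obtain ⟨U, hU, hU', hBU, hf⟩ := spec hB
  set m : Fin n → ℝ := fun i => 1 - c⁻¹ * eigs B i with hm
  have hM : 1 - c⁻¹ • B = U * diagonal m * Uᵀ := by
    have : diagonal m = 1 - c⁻¹ • diagonal (eigs B) := by
      rw [← diagonal_one, ← diagonal_smul, diagonal_sub]; rfl
    rw [this, Matrix.mul_sub, Matrix.sub_mul, Matrix.mul_one, hU', Matrix.mul_smul,
      Matrix.smul_mul, ← hBU]
  have hmi : ∀ i, |m i| < 1 := by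
    intro i
    have h1 : Uᵀ * (1 - c⁻¹ • B) * U = diagonal m := conj_inv hU hM
    have h2 : ‖diagonal m‖ ≤ ‖1 - c⁻¹ • B‖ := by
      rw [← h1]
      have := norm_conj_le (U := Uᵀ) (B := 1 - c⁻¹ • B) (by simpa using hU') (by simpa using hU)
      simpa using this
    rw [Matrix.l2_opNorm_diagonal] at h2
    exact ((norm_le_pi_norm m i).trans h2).trans_lt h
  have hs : HasSum (fun k : ℕ => fun i => (1 / ((k : ℝ) + 1)) * m i ^ (k + 1))
      (fun i => Real.log c - Real.log (eigs B i)) := by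
    rw [Pi.hasSum]
    intro i
    have h1 := Real.hasSum_pow_div_log_of_abs_lt_one (hmi i)
    convert h1 using 1
    · funext k; ring
    · have h0 : 0 < eigs B i := by
        have := (abs_lt.1 (hmi i)).2
        have h2 : 0 < c⁻¹ * eigs B i := by rw [hm] at this; simp only at this; linarith
        exact (pos_iff_pos_of_mul_pos h2).1 (inv_pos.2 hc)
      have : 1 - m i = eigs B i / c := by rw [hm]; ring
      rw [this, Real.log_div h0.ne' hc.ne']; ring
  have hs2 := ((hs.matrix_diagonal).mul_left U).mul_right Uᵀ
  convert! hs2 using 1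
  · funext k
    rw [hM, conj_pow' hU hU', diagonal_pow]
    have : diagonal (fun i => (1 / ((k : ℝ) + 1)) * m i ^ (k + 1))
       = (1 / ((k : ℝ) + 1)) • diagonal (m ^ (k + 1)) := by
      rw [← diagonal_smul]; rfl
    rw [this, Matrix.mul_smul, Matrix.smul_mul]
  · rw [hf]
    have : diagonal (fun i => Real.log c - Real.log (eigs B i))
       = Real.log c • (1 : Matrix (Fin n) (Fin n) ℝ) - diagonal (Real.log ∘ eigs B) := by
      rw [← diagonal_one, ← diagonal_smul, diagonal_sub]
      congr 1; funext i; simp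
    rw [this, Matrix.mul_sub, Matrix.sub_mul, Matrix.mul_smul, Matrix.smul_mul, Matrix.mul_one, hU']

lemma mlog_deriv {n : ℕ} [Nonempty (Fin n)] (Y Y' : ℝ → Matrix (Fin n) (Fin n) ℝ)
    (hY : ∀ t, (Y t).IsHermitian) (hd : ∀ t, HasDerivAt Y (Y' t) t) (hY' : Continuous Y')
    (t₀ : ℝ) (U : Matrix (Fin n) (Fin n) ℝ) (ev : Fin n → ℝ) (hU : Uᵀ * U = 1) (hU' : U * Uᵀ = 1)
    (hev : ∀ i, 0 < ev i) (hYU : Y t₀ = U * diagonal ev * Uᵀ) :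
    ∃ X' : Matrix (Fin n) (Fin n) ℝ, HasDerivAt (fun t => mfun (Y t) Real.log) X' t₀ ∧
      ∀ i j, (Uᵀ * X' * U) i j = lam (ev i) (ev j) * (Uᵀ * Y' t₀ * U) i j := by
  -- choose c
  obtain ⟨c, hc, hcev⟩ : ∃ c : ℝ, 0 < c ∧ ∀ i, ev i < c := by
    refine ⟨‖ev‖ + 1, by positivity, fun i => ?_⟩
    have := norm_le_pi_norm ev i
    rw [Real.norm_eq_abs] at this
    linarith [le_abs_self (ev i)]
  set M : ℝ → Matrix (Fin n) (Fin n) ℝ := fun t => 1 - c⁻¹ • Y t with hM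
  set M' : ℝ → Matrix (Fin n) (Fin n) ℝ := fun t => -(c⁻¹ • Y' t) with hM'
  have hMd : ∀ t, HasDerivAt M (M' t) t := fun t => ((hd t).const_smul c⁻¹).const_sub 1
  set m : Fin n → ℝ := fun i => 1 - ev i / c with hm
  have hmi : ∀ i, |m i| < 1 := by
    intro i
    have h1 : 0 < ev i / c := div_pos (hev i) hc
    have h2 : ev i / c < 1 := (div_lt_one hc).2 (hcev i)
    rw [abs_lt]; constructor <;> simp only [hm] <;> linarith
  have hM0 : M t₀ = U * diagonal m * Uᵀ := by
    have : diagonal m = 1 - c⁻¹ • diagonal ev := by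
      rw [← diagonal_one, ← diagonal_smul, diagonal_sub]
      congr 1; funext i; simp [hm]; ring
    rw [this, Matrix.mul_sub, Matrix.sub_mul, Matrix.mul_one, hU', Matrix.mul_smul,
      Matrix.smul_mul, ← hYU]
  have hM0n : ‖M t₀‖ < 1 := by
    rw [hM0]
    refine (norm_conj_le hU hU').trans_lt ?_
    rw [Matrix.l2_opNorm_diagonal, pi_norm_lt_iff one_pos]
    exact hmi
  obtain ⟨r, hr0, hr1⟩ := exists_between hM0n
  have hr : 0 ≤ r := (norm_nonneg _).trans hr0.le
  set C := ‖M' t₀‖ + 1 with hC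
  have hMc : Continuous M := continuous_iff_continuousAt.2 fun t => (hMd t).continuousAt
  have hM'c : Continuous M' := by
    have : Continuous fun t => c⁻¹ • Y' t := hY'.const_smul c⁻¹
    exact this.neg
  have hev1 : ∀ᶠ t in nhds t₀, ‖M t‖ < r ∧ ‖M' t‖ < C := by
    have h1 : ∀ᶠ t in nhds t₀, ‖M t‖ < r :=
      (hMc.norm.continuousAt).eventually_lt continuousAt_const hr0
    have h2 : ∀ᶠ t in nhds t₀, ‖M' t‖ < C :=
      (hM'c.norm.continuousAt).eventually_lt continuousAt_const (by rw [hC]; linarith)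
    exact h1.and h2
  obtain ⟨ε, hε, hball⟩ := Metric.eventually_nhds_iff_ball.1 hev1
  set g : ℕ → ℝ → Matrix (Fin n) (Fin n) ℝ := fun k t => (1 / ((k : ℝ) + 1)) • (M t) ^ (k + 1)
    with hg
  set g' : ℕ → ℝ → Matrix (Fin n) (Fin n) ℝ := fun k t => (1 / ((k : ℝ) + 1)) •
    ∑ i ∈ Finset.range (k + 1), M t ^ ((k + 1).pred - i) * M' t * M t ^ i with hg'
  have hgd : ∀ k t, t ∈ Metric.ball t₀ ε → HasDerivAt (g k) (g' k t) t := by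
    intro k t _
    exact ((hMd t).fun_pow' (k + 1)).const_smul (1 / ((k : ℝ) + 1))
  have hgb : ∀ k t, t ∈ Metric.ball t₀ ε → ‖g' k t‖ ≤ r ^ k * C := by
    intro k t ht
    obtain ⟨h1, h2⟩ := hball t ht
    have hterm : ∀ i ∈ Finset.range (k + 1),
        ‖M t ^ ((k + 1).pred - i) * M' t * M t ^ i‖ ≤ r ^ k * C := by
      intro i hi
      have hi := Finset.mem_range.1 hi
      calc ‖M t ^ ((k + 1).pred - i) * M' t * M t ^ i‖
          ≤ ‖M t ^ ((k + 1).pred - i)‖ * ‖M' t‖ * ‖M t ^ i‖ :=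
            (norm_mul_le _ _).trans (mul_le_mul_of_nonneg_right (norm_mul_le _ _) (norm_nonneg _))
        _ ≤ ‖M t‖ ^ (k - i) * ‖M' t‖ * ‖M t‖ ^ i := by
            gcongr
            · exact norm_pow_le _ _
            · exact norm_pow_le _ _
        _ ≤ r ^ (k - i) * C * r ^ i := by gcongr
        _ = r ^ k * C := by
            have : r ^ k = r ^ (k - i) * r ^ i := by rw [← pow_add]; congr 1; omega
            rw [this]; ring
    have h3 := norm_sum_le_of_le _ hterm
    rw [Finset.sum_const, Finset.card_range, nsmul_eq_mul] at h3
    have h4 : ‖g' k t‖ = (1 / ((k : ℝ) + 1)) *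
        ‖∑ i ∈ Finset.range (k + 1), M t ^ ((k + 1).pred - i) * M' t * M t ^ i‖ := by
      simp only [hg']
      rw [norm_smul, Real.norm_of_nonneg (by positivity)]
    rw [h4]
    calc _ ≤ (1 / ((k : ℝ) + 1)) * (((k + 1 : ℕ) : ℝ) * (r ^ k * C)) := by gcongr
      _ = r ^ k * C := by push_cast; field_simp
  have hsum : Summable fun k : ℕ => r ^ k * C :=
    (summable_geometric_of_lt_one hr hr1).mul_right C
  have ht0 : t₀ ∈ Metric.ball t₀ ε := Metric.mem_ball_self hε
  have hlog : ∀ t ∈ Metric.ball t₀ ε, HasSum (fun k => g k t)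
      ((Real.log c) • (1 : Matrix (Fin n) (Fin n) ℝ) - mfun (Y t) Real.log) := fun t ht =>
    mlog_hasSum (hY t) hc ((hball t ht).1.trans hr1)
  have hD := hasDerivAt_tsum_of_isPreconnected hsum Metric.isOpen_ball
    (convex_ball t₀ ε).isPreconnected hgd hgb ht0 (hlog t₀ ht0).summable ht0
  refine ⟨-(∑' k, g' k t₀), ?_, ?_⟩
  · have h1 := hD.const_sub ((Real.log c) • (1 : Matrix (Fin n) (Fin n) ℝ))
    refine h1.congr_of_eventuallyEq ?_
    filter_upwards [Metric.ball_mem_nhds t₀ hε] with t ht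
    rw [(hlog t ht).tsum_eq]
    abel
  · intro i j
    have hs' : Summable fun k => g' k t₀ :=
      Summable.of_norm_bounded hsum (fun k => hgb k t₀ ht0)
    have h1 := ((hs'.hasSum).mul_left Uᵀ).mul_right U
    have h2 : HasSum (fun k => (Uᵀ * g' k t₀ * U) i j) ((Uᵀ * (∑' k, g' k t₀) * U) i j) :=
      Pi.hasSum.1 (Pi.hasSum.1 h1 i) j
    have h3 := (lam_hasSum hc (hmi i) (hmi j)).mul_right (-(c⁻¹ * (Uᵀ * Y' t₀ * U) i j))
    have h4 : ∀ k, (Uᵀ * g' k t₀ * U) i j = (1 / ((k : ℝ) + 1)) *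
      (∑ l ∈ Finset.range (k + 1), (1 - ev i / c) ^ (k - l) * (1 - ev j / c) ^ l)
       * (-(c⁻¹ * (Uᵀ * Y' t₀ * U) i j)) := by
      intro k
      simp only [hg', Matrix.mul_smul, Matrix.smul_mul, Matrix.smul_apply, smul_eq_mul,
        Matrix.mul_sum, Matrix.sum_mul, Matrix.sum_apply]
      rw [mul_assoc, Finset.sum_mul]
      congr 1
      apply Finset.sum_congr rfl
      intro l hl
      have e : Uᵀ * (M t₀ ^ ((k + 1).pred - l) * M' t₀ * M t₀ ^ l) * U
        = diagonal (m ^ (k - l)) * (Uᵀ * M' t₀ * U) * diagonal (m ^ l) := by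
        rw [hM0, conj_pow' hU hU', conj_pow' hU hU', diagonal_pow, diagonal_pow]
        calc _ = (Uᵀ * U) * diagonal (m ^ (k - l)) * (Uᵀ * M' t₀ * U) * diagonal (m ^ l) * (Uᵀ * U) := by
              simp only [Matrix.mul_assoc, Nat.pred_succ]
          _ = _ := by rw [hU]; simp
      rw [e, mul_diagonal, diagonal_mul]
      have e2 : (Uᵀ * M' t₀ * U) i j = -(c⁻¹ * (Uᵀ * Y' t₀ * U) i j) := by
        simp [hM']
      rw [e2]
      simp only [Pi.pow_apply, hm]
      ring
    have h5 : (Uᵀ * (∑' k, g' k t₀) * U) i j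
        = c * lam (ev i) (ev j) * (-(c⁻¹ * (Uᵀ * Y' t₀ * U) i j)) := by
      refine h2.unique ?_
      simpa only [h4] using h3
    rw [Matrix.mul_neg, Matrix.neg_mul, Matrix.neg_apply, h5]
    field_simp


lemma lam_self {a : ℝ} : lam a a = a⁻¹ := by simp [lam]

lemma lam_comm (a b : ℝ) : lam a b = lam b a := by
  unfold lam
  by_cases h : a = b
  · subst h; rfl
  · rw [if_neg h, if_neg (Ne.symm h), ← neg_sub b a, ← neg_sub (Real.log b), neg_div_neg_eq]

lemma lam_bound_aux {a b B K : ℝ} (hb : 0 < b) (hab : b < a)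
    (h : ((Real.log a - Real.log b) / 2) ^ 2 ≤ B ^ 2) (hB : 0 < B)
    (hK : K = B * Real.cosh B / Real.sinh B) : lam a b * ((a + b) / 2) ≤ K := by
  have ha : 0 < a := hb.trans hab
  set s := (Real.log a - Real.log b) / 2 with hs
  set g := Real.exp ((Real.log a + Real.log b) / 2) with hg
  have hspos : 0 < s := by
    have := Real.log_lt_log hb hab
    rw [hs]; linarith
  have hsB : s ≤ B := abs_le_of_sq_le_sq' h hB.le |>.2
  have ea : a = g * Real.exp s := by
    rw [hg, ← Real.exp_add, hs]
    have : (Real.log a + Real.log b) / 2 + (Real.log a - Real.log b) / 2 = Real.log a := by ring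
    rw [this, Real.exp_log ha]
  have eb : b = g * Real.exp (-s) := by
    rw [hg, ← Real.exp_add, hs]
    have : (Real.log a + Real.log b) / 2 + -((Real.log a - Real.log b) / 2) = Real.log b := by ring
    rw [this, Real.exp_log hb]
  have hgpos : 0 < g := Real.exp_pos _
  have e1 : a + b = 2 * g * Real.cosh s := by
    rw [Real.cosh_eq]; linarith
  have e2 : a - b = 2 * g * Real.sinh s := by
    rw [Real.sinh_eq]; linarith
  have hsh : 0 < Real.sinh s := Real.sinh_pos_iff.2 hspos
  have hshB : 0 < Real.sinh B := Real.sinh_pos_iff.2 hB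
  have e3 : Real.log a - Real.log b = 2 * s := by rw [hs]; ring
  have : lam a b * ((a + b) / 2) = s * Real.cosh s / Real.sinh s := by
    unfold lam
    rw [if_neg hab.ne', e1, e2, e3]
    field_simp
  rw [this, hK, div_le_div_iff₀ hsh hshB]
  exact coth_mono hspos hsB

lemma one_le_K {B K : ℝ} (hB : 0 < B) (hK : K = B * Real.cosh B / Real.sinh B) : 1 ≤ K := by
  rw [hK, one_le_div (Real.sinh_pos_iff.2 hB)]
  exact sinh_le_mul_cosh hB.le

lemma lam_bound {a b B K : ℝ} (ha : 0 < a) (hb : 0 < b)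
    (h : ((Real.log a - Real.log b) / 2) ^ 2 ≤ B ^ 2) (hB : 0 < B)
    (hK : K = B * Real.cosh B / Real.sinh B) : lam a b * ((a + b) / 2) ≤ K := by
  rcases lt_trichotomy a b with h1 | h1 | h1
  · rw [lam_comm, add_comm]
    exact lam_bound_aux ha h1 (by convert h using 1; ring) hB hK
  · subst h1
    rw [lam_self]
    have : a⁻¹ * ((a + a) / 2) = 1 := by field_simp; ring
    rw [this]
    exact one_le_K hB hK
  · exact lam_bound_aux hb h1 h hB hK

lemma hess_bound {n : ℕ} (ev : Fin n → ℝ) (hev : ∀ i, 0 < ev i) (V : Matrix (Fin n) (Fin n) ℝ)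
    (hsym : ∀ i j, ev i * V i j = ev j * V j i) (h1 : ∑ i, ∑ j, V i j * V j i = 1)
    {κ D K : ℝ} (hκ : 0 < κ) (hκ2 : κ ^ 2 = 1 / 2) (hD : 0 < D)
    (hF : ∑ i, Real.log (ev i) ^ 2 ≤ D ^ 2)
    (hK : K = κ * D * Real.cosh (κ * D) / Real.sinh (κ * D)) :
    ∑ i, ∑ j, lam (ev i) (ev j) * (ev i * V i j) * V j i
      ≤ K - (K - 1) * ((∑ i, Real.log (ev i) * V i i) ^ 2 / D ^ 2) := by
  have hK1 := one_le_K (mul_pos hκ hD) hK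
  have hq : ∀ i j, 0 ≤ V i j * V j i := by
    intro i j
    have : V j i = ev i * V i j / ev j := by
      rw [hsym i j]; field_simp [(hev j).ne']
    rw [this]
    have : V i j * (ev i * V i j / ev j) = (V i j) ^ 2 * (ev i / ev j) := by ring
    rw [this]
    exact mul_nonneg (sq_nonneg _) (div_pos (hev i) (hev j)).le
  have hs : ∑ i, ∑ j, lam (ev i) (ev j) * (ev i * V i j) * V j i
      = ∑ i, ∑ j, lam (ev i) (ev j) * ((ev i + ev j) / 2) * (V i j * V j i) := by
    have e1 : ∑ i, ∑ j, lam (ev i) (ev j) * (ev i * V i j) * V j i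
      = ∑ i, ∑ j, lam (ev i) (ev j) * (ev j * V j i) * V i j := by
      rw [Finset.sum_comm]
      refine Finset.sum_congr rfl fun i _ => Finset.sum_congr rfl fun j _ => ?_
      rw [lam_comm]
    have e2 : ∑ i, ∑ j, lam (ev i) (ev j) * ((ev i + ev j) / 2) * (V i j * V j i)
      = (∑ i, ∑ j, lam (ev i) (ev j) * (ev i * V i j) * V j i
        + ∑ i, ∑ j, lam (ev i) (ev j) * (ev j * V j i) * V i j) / 2 := by
      rw [← Finset.sum_add_distrib, Finset.sum_div]
      refine Finset.sum_congr rfl fun i _ => ?_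
      rw [← Finset.sum_add_distrib, Finset.sum_div]
      refine Finset.sum_congr rfl fun j _ => ?_
      ring
    rw [e2, ← e1]; ring
  rw [hs]
  have hb : ∀ i j, lam (ev i) (ev j) * ((ev i + ev j) / 2) * (V i j * V j i)
      ≤ K * (V i j * V j i) - (if i = j then (K - 1) * (V i j * V j i) else 0) := by
    intro i j
    split_ifs with h
    · subst h
      rw [lam_self]
      have : (ev i)⁻¹ * ((ev i + ev i) / 2) = 1 := by field_simp [(hev i).ne']; ring
      rw [this]
      linarith
    · rw [sub_zero]
      apply mul_le_mul_of_nonneg_right _ (hq i j)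
      refine lam_bound (hev i) (hev j) ?_ (mul_pos hκ hD) hK
      have h2 : Real.log (ev i) ^ 2 + Real.log (ev j) ^ 2 ≤ ∑ k, Real.log (ev k) ^ 2 := by
        rw [← Finset.sum_pair (f := fun k => Real.log (ev k) ^ 2) h]
        exact Finset.sum_le_sum_of_subset_of_nonneg (Finset.subset_univ _)
          (fun k _ _ => sq_nonneg _)
      rw [mul_pow, hκ2]
      nlinarith [sq_nonneg (Real.log (ev i) + Real.log (ev j))]
  have hsum := Finset.sum_le_sum fun i (_ : i ∈ Finset.univ) =>
    Finset.sum_le_sum fun j (_ : j ∈ Finset.univ) => hb i j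
  refine hsum.trans ?_
  simp only [Finset.sum_sub_distrib, ← Finset.mul_sum, h1, Finset.sum_ite_eq, Finset.mem_univ,
    if_true]
  have hcs := Finset.sum_mul_sq_le_sq_mul_sq Finset.univ (fun i => Real.log (ev i)) (fun i => V i i)
  have hVn : 0 ≤ ∑ i, V i i ^ 2 := Finset.sum_nonneg fun i _ => sq_nonneg _
  have h3 : (∑ i, Real.log (ev i) * V i i) ^ 2 / D ^ 2 ≤ ∑ i, V i i ^ 2 := by
    rw [div_le_iff₀ (by positivity)]
    nlinarith
  have h4 : ∑ i, V i i * V i i = ∑ i, V i i ^ 2 := Finset.sum_congr rfl fun i _ => by ring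
  rw [h4, mul_one]
  nlinarith [mul_le_mul_of_nonneg_left h3 (sub_nonneg.2 hK1)]

lemma trace_conj {n : ℕ} {U A B : Matrix (Fin n) (Fin n) ℝ} (hU' : U * Uᵀ = 1) :
    (A * B).trace = ((Uᵀ * A * U) * (Uᵀ * B * U)).trace := by
  have : (Uᵀ * A * U) * (Uᵀ * B * U) = Uᵀ * (A * B * U) := by
    calc _ = Uᵀ * A * (U * Uᵀ) * B * U := by simp only [Matrix.mul_assoc]
      _ = _ := by rw [hU']; simp only [Matrix.mul_assoc, Matrix.mul_one]
  rw [this, Matrix.trace_mul_comm Uᵀ, Matrix.mul_assoc (A * B), hU', Matrix.mul_one]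

lemma trace_hasDerivAt {n : ℕ} {X : ℝ → Matrix (Fin n) (Fin n) ℝ} {X' : Matrix (Fin n) (Fin n) ℝ}
    {t : ℝ} (h : HasDerivAt X X' t) : HasDerivAt (fun s => (X s).trace) X'.trace t := by
  have := (LinearMap.toContinuousLinearMap (Matrix.traceLinearMap (Fin n) ℝ ℝ)).hasFDerivAt.comp_hasDerivAt t h
  exact this

lemma core {n : ℕ} [Nonempty (Fin n)] (S Si W : Matrix (Fin n) (Fin n) ℝ)
    (hS : S.IsHermitian) (h1 : S * Si = 1) (h2 : Si * S = 1) (hW : W.IsHermitian)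
    (htr : (W * W).trace = 1) {κ : ℝ} (hκ : 0 < κ) (hκ2 : κ ^ 2 = 1 / 2)
    (F : ℝ → ℝ)
    (hF : ∀ t, F t = ∑ i, Real.log (eigs (S * NormedSpace.exp (t • W) * S) i) ^ 2)
    (hF0 : 0 < F 0) (t : ℝ) (ht : 0 ≤ t) :
    F t ≤ F 0 + Real.sinh (t * κ) / κ *
      (κ * √(F 0) / Real.tanh (κ * √(F 0)) * t + 
        2 * (mfun (S * NormedSpace.exp ((0:ℝ) • W) * S) Real.log * (Si * W * S)).trace) := by
  set Y : ℝ → Matrix (Fin n) (Fin n) ℝ := fun t => S * NormedSpace.exp (t • W) * S with hYdef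
  set V := Si * W * S with hV
  have hEherm : ∀ s : ℝ, (NormedSpace.exp (s • W)).IsHermitian := fun s => by
    apply Matrix.IsHermitian.exp
    rw [Matrix.IsHermitian, conjTranspose_smul, hW.eq]; simp
  have hY : ∀ t, (Y t).IsHermitian := fun s => by
    have := Matrix.isHermitian_conjTranspose_mul_mul S (hEherm s)
    rwa [hS.eq] at this
  have hYpos : ∀ t, (Y t).PosDef := by
    intro s
    set Z := NormedSpace.exp ((s / 2) • W) * S with hZ
    have hZZ : Y s = Zᴴ * Z := by
      have e : NormedSpace.exp (s • W) =
          NormedSpace.exp ((s / 2) • W) * NormedSpace.exp ((s / 2) • W) := by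
        rw [← Matrix.exp_add_of_commute _ _ (Commute.refl _), ← add_smul]
        congr 2; ring
      rw [hZ, conjTranspose_mul, hS.eq, (hEherm _).eq, hYdef]
      simp only
      rw [e]; simp only [Matrix.mul_assoc]
    rw [hZZ]
    refine Matrix.PosDef.conjTranspose_mul_self _ ?_
    have hinv : (Si * NormedSpace.exp (-((s / 2) • W))) * Z = 1 := by
      rw [hZ]
      calc _ = Si * (NormedSpace.exp (-((s / 2) • W)) * NormedSpace.exp ((s / 2) • W)) * S := by
            simp only [Matrix.mul_assoc]
        _ = 1 := by
            have hc : Commute (-((s / 2) • W)) ((s / 2) • W) :=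
              (Commute.refl ((s / 2) • W)).neg_left
            rw [← Matrix.exp_add_of_commute _ _ hc]
            simp [h2]
    intro x y hxy
    have h3 := congrArg (fun z => (Si * NormedSpace.exp (-((s / 2) • W))) *ᵥ z) hxy
    simpa only [Matrix.mulVec_mulVec, hinv, Matrix.one_mulVec] using h3
  set Y' : ℝ → Matrix (Fin n) (Fin n) ℝ := fun t => S * (NormedSpace.exp (t • W) * W) * S with hY'def
  have hd : ∀ t, HasDerivAt Y (Y' t) t := fun s =>
    ((hasDerivAt_exp_smul_const W s).const_mul S).mul_const S
  have hY'c : Continuous Y' := by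
    have : Continuous fun t : ℝ => NormedSpace.exp (t • W) := 
      continuous_iff_continuousAt.2 fun t => (hasDerivAt_exp_smul_const W t).continuousAt
    exact ((continuous_const.mul (this.mul continuous_const)).mul continuous_const)
  have hY'V : ∀ s, Y' s = Y s * V := by
    intro s
    simp only [hY'def, hYdef, hV]
    calc _ = S * NormedSpace.exp (s • W) * 1 * W * S := by simp [Matrix.mul_assoc]
      _ = _ := by rw [← h1]; simp only [Matrix.mul_assoc]
  have hY'h : ∀ s, (Y' s).IsHermitian := by
    intro s
    have hcom : NormedSpace.exp (s • W) * W = W * NormedSpace.exp (s • W) :=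
      (((Commute.refl W).smul_left s).exp_left).eq
    rw [Matrix.IsHermitian]
    simp only [hY'def]
    rw [conjTranspose_mul, conjTranspose_mul, conjTranspose_mul, hS.eq, hW.eq, (hEherm s).eq,
      ← hcom]
    simp only [Matrix.mul_assoc]
  have hVV : (V * V).trace = 1 := by
    rw [← htr, hV]
    calc (Si * W * S * (Si * W * S)).trace = (Si * (W * (S * Si) * W * S)).trace := by
          simp only [Matrix.mul_assoc]
      _ = _ := by
        rw [Matrix.trace_mul_comm, h1, Matrix.mul_one, Matrix.mul_assoc, h1, Matrix.mul_one]
  set X : ℝ → Matrix (Fin n) (Fin n) ℝ := fun t => mfun (Y t) Real.log with hX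
  -- pointwise package
  have key : ∀ s, ∃ X' : Matrix (Fin n) (Fin n) ℝ, HasDerivAt X X' s ∧
      (X s * X s).trace = F s ∧ (X s * X').trace = (X s * V).trace ∧
      ∀ D K, 0 < D → F s ≤ D ^ 2 → K = κ * D * Real.cosh (κ * D) / Real.sinh (κ * D) →
        (X' * V).trace ≤ K - (K - 1) * ((X s * V).trace ^ 2 / D ^ 2) := by
    intro s
    obtain ⟨U, hU, hU', hYU, hf⟩ := spec (hY s)
    set ev := eigs (Y s) with hev
    have hevpos : ∀ i, 0 < ev i := by
      intro i
      have : ev = (hY s).eigenvalues := by rw [hev, eigs, dif_pos (hY s)]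
      rw [this]
      exact (hYpos s).eigenvalues_pos i
    obtain ⟨X', hX', hent⟩ := mlog_deriv Y Y' hY hd hY'c s U ev hU hU' hevpos hYU
    have hXs : Uᵀ * X s * U = diagonal (Real.log ∘ ev) := conj_inv hU (hf Real.log)
    set Vt := Uᵀ * V * U with hVt
    have hYs : Uᵀ * Y s * U = diagonal ev := conj_inv hU hYU
    have hH : ∀ i j, (Uᵀ * Y' s * U) i j = ev i * Vt i j := by
      intro i j
      have : Uᵀ * Y' s * U = (Uᵀ * Y s * U) * Vt := by
        rw [hY'V, hVt]
        calc _ = Uᵀ * Y s * 1 * V * U := by simp [Matrix.mul_assoc]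
          _ = _ := by rw [← hU']; simp only [Matrix.mul_assoc]
      rw [this, hYs, diagonal_mul]
    have hHsym : ∀ i j, ev i * Vt i j = ev j * Vt j i := by
      intro i j
      rw [← hH, ← hH]
      have : (Uᵀ * Y' s * U)ᵀ = Uᵀ * Y' s * U := by
        have h3 : (Y' s)ᵀ = Y' s := by
          have := (hY'h s).eq
          rwa [conjTranspose_eq_transpose_of_trivial] at this
        rw [transpose_mul, transpose_mul, transpose_transpose, h3]
        exact (Matrix.mul_assoc _ _ _).symm
      exact congrFun (congrFun this.symm i) j
    have hFs : F s = ∑ i, Real.log (ev i) ^ 2 := hF s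
    have hG : (X s * V).trace = ∑ i, Real.log (ev i) * Vt i i := by
      rw [trace_conj hU', hXs]
      simp [Matrix.trace, diagonal_mul, hVt]
    refine ⟨X', hX', ?_, ?_, ?_⟩
    · rw [trace_conj hU', hXs, diagonal_mul_diagonal, trace_diagonal, hFs]
      exact Finset.sum_congr rfl fun i _ => by simp [sq]
    · rw [hG, trace_conj hU', hXs]
      simp only [Matrix.trace, Matrix.diag, diagonal_mul, Function.comp_apply]
      refine Finset.sum_congr rfl fun i _ => ?_
      rw [hent, hH, lam_self]
      have := (hevpos i).ne'
      field_simp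
    · intro D K hD hFD hK
      rw [hG, trace_conj hU']
      have e : ((Uᵀ * X' * U) * (Uᵀ * V * U)).trace
          = ∑ i, ∑ j, lam (ev i) (ev j) * (ev i * Vt i j) * Vt j i := by
        simp only [Matrix.trace, Matrix.diag, Matrix.mul_apply (M := Uᵀ * X' * U)]
        refine Finset.sum_congr rfl fun i _ => Finset.sum_congr rfl fun j _ => ?_
        rw [hent, hH]
      rw [e]
      refine hess_bound ev hevpos Vt hHsym ?_ hκ hκ2 hD (by rw [← hFs]; exact hFD) hK
      rw [trace_conj hU'] at hVV
      rw [← hVV]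
      simp only [Matrix.trace, Matrix.diag, Matrix.mul_apply (M := Uᵀ * V * U), hVt]
  choose X' hXd hXF hXX hXb using key
  refine scalar_comp0 κ hκ F (fun s => (X s * V).trace) (fun s => (X' s * V).trace)
    (fun s => by rw [hF]; exact Finset.sum_nonneg fun i _ => sq_nonneg _) hF0 ?_ ?_
    (fun s D K => hXb s D K) t ht
  · intro s
    have h := trace_hasDerivAt ((hXd s).mul (hXd s))
    have e : (X' s * X s + X s * X' s).trace = 2 * (X s * V).trace := by
      rw [Matrix.trace_add, Matrix.trace_mul_comm (X' s), hXX]; ring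
    rw [e] at h
    have e2 : F = fun s => (X s * X s).trace := funext fun s => (hXF s).symm
    rw [e2]
    exact h
  · intro s
    exact trace_hasDerivAt ((hXd s).mul_const V)


lemma eigs_pos {n : ℕ} {p : Matrix (Fin n) (Fin n) ℝ} (hp : p.PosDef) (i : Fin n) :
    0 < eigs p i := by
  rw [eigs, dif_pos hp.1]
  exact hp.eigenvalues_pos i

lemma conj_mul {n : ℕ} {U A B : Matrix (Fin n) (Fin n) ℝ} (hU : Uᵀ * U = 1) :
    (U * A * Uᵀ) * (U * B * Uᵀ) = U * (A * B) * Uᵀ := by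
  calc _ = U * A * (Uᵀ * U) * B * Uᵀ := by simp only [Matrix.mul_assoc]
    _ = _ := by rw [hU]; simp only [Matrix.mul_assoc, Matrix.mul_one]

lemma inj_of_left_inv {n : ℕ} {A B : Matrix (Fin n) (Fin n) ℝ} (h : A * B = 1) :
    Function.Injective B.mulVec := by
  intro x y hxy
  have h3 := congrArg (fun z => A *ᵥ z) hxy
  simpa only [Matrix.mulVec_mulVec, h, Matrix.one_mulVec] using h3

lemma mfun_herm {n : ℕ} {p : Matrix (Fin n) (Fin n) ℝ} (hp : p.IsHermitian) (f : ℝ → ℝ) :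
    (mfun p f).IsHermitian := by
  obtain ⟨U, hU, hU', hpU, hf⟩ := spec hp
  rw [hf, Matrix.IsHermitian, conjTranspose_eq_transpose_of_trivial, transpose_mul, transpose_mul,
    transpose_transpose, diagonal_transpose, Matrix.mul_assoc]

lemma mfun_posDef {n : ℕ} {p : Matrix (Fin n) (Fin n) ℝ} (hp : p.IsHermitian) (f : ℝ → ℝ)
    (hf0 : ∀ i, 0 < f (eigs p i)) : (mfun p f).PosDef := by
  obtain ⟨U, hU, hU', hpU, hf⟩ := spec hp
  rw [hf]
  have h1 : (diagonal (f ∘ eigs p)).PosDef := Matrix.PosDef.diagonal hf0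
  have h2 := h1.conjTranspose_mul_mul_same (B := Uᵀ) (inj_of_left_inv hU')
  rwa [conjTranspose_eq_transpose_of_trivial, transpose_transpose] at h2

lemma msqrt_sq {n : ℕ} {p : Matrix (Fin n) (Fin n) ℝ} (hp : p.PosDef) :
    msqrt p * msqrt p = p := by
  obtain ⟨U, hU, hU', hpU, hf⟩ := spec hp.1
  rw [msqrt, hf, conj_mul hU, diagonal_mul_diagonal]
  conv_rhs => rw [hpU]
  congr 3
  ext i
  exact Real.mul_self_sqrt (eigs_pos hp i).le

lemma mfun_comm {n : ℕ} {p : Matrix (Fin n) (Fin n) ℝ} (hp : p.IsHermitian) (f g : ℝ → ℝ) :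
    mfun p f * mfun p g = mfun p g * mfun p f := by
  obtain ⟨U, hU, hU', hpU, hf⟩ := spec hp
  rw [hf, hf, conj_mul hU, conj_mul hU, diagonal_mul_diagonal, diagonal_mul_diagonal]
  congr 3
  ext i
  exact mul_comm _ _

lemma msqrt_posDef {n : ℕ} {p : Matrix (Fin n) (Fin n) ℝ} (hp : p.PosDef) :
    (msqrt p).PosDef :=
  mfun_posDef hp.1 _ fun i => Real.sqrt_pos.2 (eigs_pos hp i)

lemma posDef_mul_inv {n : ℕ} {p : Matrix (Fin n) (Fin n) ℝ} (hp : p.PosDef) : p * p⁻¹ = 1 :=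
  Matrix.mul_nonsing_inv _ hp.det_pos.ne'.isUnit

lemma posDef_inv_mul {n : ℕ} {p : Matrix (Fin n) (Fin n) ℝ} (hp : p.PosDef) : p⁻¹ * p = 1 :=
  Matrix.nonsing_inv_mul _ hp.det_pos.ne'.isUnit

lemma inv_eq_msqrt {n : ℕ} {p : Matrix (Fin n) (Fin n) ℝ} (hp : p.PosDef) :
    p⁻¹ = (msqrt p)⁻¹ * (msqrt p)⁻¹ := by
  conv_lhs => rw [← msqrt_sq hp]
  exact Matrix.mul_inv_rev _ _

lemma conj_posDef {n : ℕ} {A P : Matrix (Fin n) (Fin n) ℝ} (hA : A.PosDef) (hP : P.PosDef) :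
    (P * A * P).PosDef := by
  have h2 := hA.conjTranspose_mul_mul_same (B := P) (inj_of_left_inv (posDef_inv_mul hP))
  rwa [hP.1.eq] at h2

lemma conj_herm {n : ℕ} {A P : Matrix (Fin n) (Fin n) ℝ} (hA : A.IsHermitian)
    (hP : P.IsHermitian) : (P * A * P).IsHermitian := by
  have := Matrix.isHermitian_conjTranspose_mul_mul P hA
  rwa [hP.eq] at this

lemma eigs_congr {n : ℕ} {A B : Matrix (Fin n) (Fin n) ℝ} (hA : A.IsHermitian)
    (hB : B.IsHermitian) (h : A.charpoly = B.charpoly) : eigs A = eigs B := by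
  rw [eigs, eigs, dif_pos hA, dif_pos hB]
  exact (Matrix.IsHermitian.eigenvalues_eq_eigenvalues_iff hA hB).2 h

lemma mfun_exp {n : ℕ} {B : Matrix (Fin n) (Fin n) ℝ} (hB : B.IsHermitian) :
    mfun B Real.exp = NormedSpace.exp B := by
  obtain ⟨U, hU, hU', hpU, hf⟩ := spec hB
  have hi : U⁻¹ = Uᵀ := Matrix.inv_eq_right_inv hU'
  have hu : IsUnit U := ⟨⟨U, Uᵀ, hU', hU⟩, rfl⟩
  rw [hf]
  conv_rhs => rw [hpU]
  rw [← hi, Matrix.exp_conj _ _ hu, Matrix.exp_diagonal]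
  congr 3
  ext i
  rw [Pi.coe_exp, ← Real.exp_eq_exp_ℝ]
  rfl

lemma eq_one_of_log {n : ℕ} {A : Matrix (Fin n) (Fin n) ℝ} (hA : A.PosDef)
    (h : ∑ i, Real.log (eigs A i) ^ 2 ≤ 0) : A = 1 := by
  have h0 : ∑ i, Real.log (eigs A i) ^ 2 = 0 :=
    le_antisymm h (Finset.sum_nonneg fun i _ => sq_nonneg _)
  rw [Finset.sum_eq_zero_iff_of_nonneg fun i _ => sq_nonneg _] at h0
  obtain ⟨U, hU, hU', hpU, -⟩ := spec hA.1
  have : eigs A = 1 := by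
    ext i
    have h1 := pow_eq_zero_iff (two_ne_zero) |>.1 (h0 i (Finset.mem_univ i))
    exact Real.eq_one_of_pos_of_log_eq_zero (eigs_pos hA i) h1
  rw [hpU, this]
  simp [hU']

lemma trace_sq_pos {n : ℕ} {B : Matrix (Fin n) (Fin n) ℝ} (hB : B.IsHermitian) (h : B ≠ 0) :
    0 < (B * B).trace := by
  have h1 : 0 ≤ (B * B).trace := by
    have := (Matrix.posSemidef_conjTranspose_mul_self B).trace_nonneg
    rwa [hB.eq] at this
  refine lt_of_le_of_ne h1 fun h2 => h ?_
  have := (Matrix.trace_conjTranspose_mul_self_eq_zero_iff (A := B)).1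
  rw [hB.eq] at this
  exact this h2.symm

lemma khat_pos : 0 < khat := by unfold khat; positivity

lemma khat_sq : khat ^ 2 = 1 / 2 := by
  unfold khat
  rw [inv_pow, Real.sq_sqrt (by norm_num)]; norm_num

lemma main {n : ℕ} (p q : Matrix (Fin n) (Fin n) ℝ)
    (hp : p.PosDef) (hq : q.PosDef) (hpq : p ≠ q)
    (v : Matrix (Fin n) (Fin n) ℝ) (hv : v.IsHermitian) (hv0 : v ≠ 0) (t : ℝ) (ht : 0 ≤ t) :
      dR (mexpP p (-(t / mnorm p v) • v)) q ^ 2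
        ≤ dR p q ^ 2
          + (Real.sinh (t * khat) / khat) *
              ((khat * dR p q / Real.tanh (khat * dR p q)) * t
                + 2 * (minner p v (mlogP p q) / mnorm p v)) := by
  have hne : Nonempty (Fin n) := by
    by_contra hcon
    rw [not_nonempty_iff] at hcon
    exact hv0 (Subsingleton.elim _ _)
  have hPpos := msqrt_posDef hp
  have hpinv := inv_eq_msqrt hp
  have hPP := msqrt_sq hp
  have hPi1 := posDef_mul_inv hPpos
  have hPi2 := posDef_inv_mul hPpos
  set P := msqrt p with hP
  set Q := P⁻¹ with hQ
  have hQpos : Q.PosDef := hPpos.inv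
  set A := Q * q * Q with hA
  have hApos : A.PosDef := conj_posDef hq hQpos
  have hSpos := msqrt_posDef hApos
  have hSS := msqrt_sq hApos
  have hS1 := posDef_mul_inv hSpos
  have hS2 := posDef_inv_mul hSpos
  have hSlog : mfun A Real.log * msqrt A = msqrt A * mfun A Real.log := mfun_comm hApos.1 _ _
  set S := msqrt A with hS
  set B := Q * v * Q with hB
  have hBh : B.IsHermitian := conj_herm hv hQpos.1
  have hB0 : B ≠ 0 := by
    intro h0
    apply hv0
    calc v = (P * Q) * v * (Q * P) := by rw [hPi1, hPi2]; simp
      _ = P * B * P := by rw [hB]; simp only [Matrix.mul_assoc]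
      _ = 0 := by rw [h0]; simp
  have hin : ∀ u w : Matrix (Fin n) (Fin n) ℝ,
      minner p u w = ((Q * u * Q) * (Q * w * Q)).trace := by
    intro u w
    rw [minner, hpinv]
    calc (Q * Q * u * (Q * Q) * w).trace = (Q * (Q * u * Q * Q * w)).trace := by
          simp only [Matrix.mul_assoc]
      _ = _ := by rw [Matrix.trace_mul_comm]; simp only [Matrix.mul_assoc]
  set m := mnorm p v with hm
  have hm2 : m ^ 2 = (B * B).trace := by
    rw [hm, mnorm, hin, Real.sq_sqrt (trace_sq_pos hBh hB0).le]
  have hmpos : 0 < m := by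
    rw [hm, mnorm, hin]
    exact Real.sqrt_pos.2 (trace_sq_pos hBh hB0)
  set W := m⁻¹ • B with hW
  have hWh : W.IsHermitian := by
    rw [Matrix.IsHermitian, hW, conjTranspose_smul, hBh.eq]; simp
  have hWW : (W * W).trace = 1 := by
    rw [hW, smul_mul_smul_comm, Matrix.trace_smul, ← hm2, smul_eq_mul]
    field_simp
  have hEh : ∀ s : ℝ, (s • W).IsHermitian := fun s => by
    rw [Matrix.IsHermitian, conjTranspose_smul, hWh.eq]; simp
  have hEpos : ∀ s : ℝ, (NormedSpace.exp (s • W)).PosDef := fun s => by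
    rw [← mfun_exp (hEh s)]
    exact mfun_posDef (hEh s) _ fun i => Real.exp_pos _
  -- distance along the geodesic
  have hgam : ∀ s : ℝ, mexpP p (-(s / m) • v) = P * NormedSpace.exp ((-s) • W) * P := by
    intro s
    have e : Q * (-(s / m) • v) * Q = (-s) • W := by
      rw [hW, smul_smul, hB, Matrix.mul_smul, Matrix.smul_mul]
      congr 1
      ring
    rw [mexpP, ← hP, ← hQ, e, mfun_exp (hEh _)]
  have hd : ∀ s : ℝ, dR (mexpP p (-(s / m) • v)) q ^ 2
      = ∑ i, Real.log (eigs (S * NormedSpace.exp (s • W) * S) i) ^ 2 := by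
    intro s
    rw [hgam]
    set G := P * NormedSpace.exp ((-s) • W) * P with hG
    have hGpos : G.PosDef := conj_posDef (hEpos _) hPpos
    have hGinv : G⁻¹ = Q * NormedSpace.exp (s • W) * Q := by
      apply Matrix.inv_eq_right_inv
      have hc : Commute ((-s) • W) (s • W) := ((Commute.refl W).smul_left _).smul_right _
      calc _ = P * NormedSpace.exp ((-s) • W) * (P * Q) * NormedSpace.exp (s • W) * Q := by
            rw [hG]; simp only [Matrix.mul_assoc]
        _ = P * (NormedSpace.exp ((-s) • W) * NormedSpace.exp (s • W)) * Q := by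
            rw [hPi1]; simp only [Matrix.mul_assoc, Matrix.one_mul]
        _ = 1 := by
            rw [← Matrix.exp_add_of_commute _ _ hc, ← add_smul]
            simp [hPi1]
    have hRpos := msqrt_posDef hGpos
    rw [dR, Real.sq_sqrt (Finset.sum_nonneg fun i _ => sq_nonneg _)]
    rw [eigs_congr (conj_herm hq.1 hRpos.inv.1) (conj_herm (hEpos s).1 hSpos.1) ?_]
    rw [Matrix.charpoly_mul_comm, ← Matrix.mul_assoc, ← inv_eq_msqrt hGpos, hGinv,
      Matrix.charpoly_mul_comm (S * NormedSpace.exp (s • W)), ← Matrix.mul_assoc, hSS,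
      Matrix.charpoly_mul_comm A, Matrix.mul_assoc, Matrix.mul_assoc, Matrix.charpoly_mul_comm Q,
      hA]
    simp only [Matrix.mul_assoc]
  have hA0 : S * NormedSpace.exp ((0:ℝ) • W) * S = A := by
    simp [hSS]
  have hF0 : ∑ i, Real.log (eigs (S * NormedSpace.exp ((0:ℝ) • W) * S) i) ^ 2 = dR p q ^ 2 := by
    rw [hA0, dR, Real.sq_sqrt (Finset.sum_nonneg fun i _ => sq_nonneg _)]
  have hdn : 0 ≤ dR p q := Real.sqrt_nonneg _
  have hF0pos : 0 < ∑ i, Real.log (eigs (S * NormedSpace.exp ((0:ℝ) • W) * S) i) ^ 2 := by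
    by_contra hcon
    rw [hA0] at hcon
    have h1 : A = 1 := eq_one_of_log hApos (not_lt.1 hcon)
    apply hpq
    calc p = P * 1 * P := by rw [Matrix.mul_one, hPP]
      _ = (P * Q) * q * (Q * P) := by rw [← h1, hA]; simp only [Matrix.mul_assoc]
      _ = q := by rw [hPi1, hPi2]; simp
  have hcore := core S S⁻¹ W hSpos.1 hS1 hS2 hWh hWW khat_pos khat_sq
    (fun s => ∑ i, Real.log (eigs (S * NormedSpace.exp (s • W) * S) i) ^ 2) (fun s => rfl)
    hF0pos t ht
  rw [hF0, Real.sqrt_sq hdn, ← hd, hA0] at hcore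
  have htr : (mfun A Real.log * (S⁻¹ * W * S)).trace = minner p v (mlogP p q) / m := by
    have e1 : (mfun A Real.log * (S⁻¹ * W * S)).trace = (W * mfun A Real.log).trace := by
      calc _ = ((mfun A Real.log * S⁻¹ * W) * S).trace := by simp only [Matrix.mul_assoc]
        _ = (S * mfun A Real.log * S⁻¹ * W).trace := by
            rw [Matrix.trace_mul_comm]; simp only [Matrix.mul_assoc]
        _ = (mfun A Real.log * (S * S⁻¹) * W).trace := by
            rw [← hSlog]; simp only [Matrix.mul_assoc]
        _ = _ := by rw [hS1, Matrix.mul_one, Matrix.trace_mul_comm]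
    have e2 : Q * mlogP p q * Q = mfun A Real.log := by
      rw [mlogP, ← hP, ← hQ, ← hA]
      calc _ = (Q * P) * mfun A Real.log * (P * Q) := by simp only [Matrix.mul_assoc]
        _ = _ := by rw [hPi1, hPi2]; simp
    rw [e1, hin, e2, ← hB, hW, Matrix.smul_mul, Matrix.trace_smul, smul_eq_mul, div_eq_inv_mul]
  rw [htr] at hcore
  exact hcore


end Helpers

end SPD

open SPD

/-- Comparison inequality on `S⁺_n` with `κ̂ = 1/√2`. -/
theorem comparison_inequality {n : ℕ} (p q : Matrix (Fin n) (Fin n) ℝ)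
    (hp : p.PosDef) (hq : q.PosDef) (hpq : p ≠ q)
    (v : Matrix (Fin n) (Fin n) ℝ) (hv : v.IsHermitian) (hv0 : v ≠ 0) :
    ∀ t : ℝ, 0 ≤ t →
      dR (mexpP p (-(t / mnorm p v) • v)) q ^ 2
        ≤ dR p q ^ 2
          + (Real.sinh (t * khat) / khat) *
              ((khat * dR p q / Real.tanh (khat * dR p q)) * t
                + 2 * (minner p v (mlogP p q) / mnorm p v)) := by
  exact fun t ht => SPD.main p q hp hq hpq v hv hv0 t ht
end

section
/- (Basic iteration inequality.) Let f : S⁺_n → ℝ be geodesically convex, let X ⊆ S⁺_n be a nonempty compact geodesically convex set with diam(X) ≤ D for some D > 0, and let {p_k} be generated by the inexact projected subgradient iteration with p₀ ∈ X, step sizes t_k and v_k = s_k + u_k ≠ 0 with s_k ∈ ∂f(p_k). Let σ > 0 with sup_k t_k ≤ σ, let κ̂ = 1/√2 and ζ := D·sinh(κ̂σ)/(σ·tanh(κ̂D)). Then for every q ∈ X and every k: d²(p_{k+1}, q) ≤ d²(p_k, q) + ζ·t_k² + 2·(sinh(κ̂ t_k)/κ̂)·( f(q) − f(p_k) + ‖u_k‖_{p_k}·D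 )/‖v_k‖_{p_k}. -/
open Matrix Real Filter

namespace SPDAux

lemma mono_of_hasDeriv {a : ℝ} {F F' : ℝ → ℝ} (h : ∀ x, a ≤ x → HasDerivAt F (F' x) x)
    (h' : ∀ x, a ≤ x → 0 ≤ F' x) : ∀ x y, a ≤ x → x ≤ y → F x ≤ F y := by
  have : MonotoneOn F (Set.Ici a) := by
    apply monotoneOn_of_deriv_nonneg (convex_Ici a)
    · intro x hx; exact (h x hx).continuousAt.continuousWithinAt
    · intro x hx
      rw [interior_Ici] at hx
      exact (h x (le_of_lt hx)).differentiableAt.differentiableWithinAt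
    · intro x hx
      rw [interior_Ici] at hx
      rw [(h x (le_of_lt hx)).deriv]; exact h' x (le_of_lt hx)
  intro x y hx hxy
  exact this hx (le_trans hx hxy) hxy

lemma sinh_le_mul_cosh {x : ℝ} (hx : 0 ≤ x) : sinh x ≤ x * cosh x := by
  have := mono_of_hasDeriv (a := 0) (F := fun x => x * cosh x - sinh x)
    (F' := fun x => 1 * cosh x + x * sinh x - cosh x)
    (fun x _ => ((hasDerivAt_id x).mul (hasDerivAt_cosh x)).sub (hasDerivAt_sinh x))
    (fun x hx => by
      have := mul_nonneg hx (sinh_nonneg_iff.2 hx); linarith) 0 x le_rfl hx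
  simp at this; linarith

lemma two_cosh_sub_one_le {t : ℝ} (ht : 0 ≤ t) : 2 * (cosh t - 1) ≤ t * sinh t := by
  have := mono_of_hasDeriv (a := 0) (F := fun x => x * sinh x - 2 * (cosh x - 1))
    (F' := fun x => 1 * sinh x + x * cosh x - 2 * sinh x)
    (fun x _ => ((hasDerivAt_id x).mul (hasDerivAt_sinh x)).sub
      (((hasDerivAt_cosh x).sub_const 1).const_mul 2))
    (fun x hx => by
      have := sinh_le_mul_cosh hx; linarith) 0 t le_rfl ht
  simp at this; linarith

/-- `x coth x`. -/
noncomputable def xcoth (x : ℝ) : ℝ := x * cosh x / sinh x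

lemma xcoth_mono {x y : ℝ} (hx : 0 < x) (hxy : x ≤ y) : xcoth x ≤ xcoth y := by
  refine mono_of_hasDeriv (a := x) (F := xcoth)
    (F' := fun x => ((1 * cosh x + x * sinh x) * sinh x - x * cosh x * cosh x) / sinh x ^ 2)
    (fun z hz => ?_) (fun z hz => ?_) x y le_rfl hxy
  · exact ((hasDerivAt_id z).mul (hasDerivAt_cosh z)).div (hasDerivAt_sinh z)
      (sinh_pos_iff.2 (lt_of_lt_of_le hx hz)).ne'
  · have hz0 : 0 ≤ z := (lt_of_lt_of_le hx hz).le
    apply div_nonneg _ (sq_nonneg _)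
    have h1 := self_le_sinh_iff.2 hz0
    have h2 := one_le_cosh z
    have h3 := cosh_sq z
    nlinarith

lemma one_le_xcoth {x : ℝ} (hx : 0 < x) : 1 ≤ xcoth x := by
  unfold xcoth
  rw [le_div_iff₀ (sinh_pos_iff.2 hx)]
  simpa using sinh_le_mul_cosh hx.le

lemma xcoth_neg (x : ℝ) : xcoth (-x) = xcoth x := by
  simp [xcoth]

lemma sinh_div_mono {x y : ℝ} (hx : 0 < x) (hxy : x ≤ y) : sinh x / x ≤ sinh y / y := by
  refine mono_of_hasDeriv (a := x) (F := fun x => sinh x / x)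
    (F' := fun x => (cosh x * x - sinh x * 1) / x ^ 2)
    (fun z hz => ?_) (fun z hz => ?_) x y le_rfl hxy
  · exact (hasDerivAt_sinh z).div (hasDerivAt_id z) (lt_of_lt_of_le hx hz).ne'
  · have hz0 : 0 ≤ z := (lt_of_lt_of_le hx hz).le
    apply div_nonneg _ (sq_nonneg _)
    have := sinh_le_mul_cosh hz0
    linarith

lemma cosh_tangent {x y : ℝ} (hx : 0 < x) (hy : 0 ≤ y) :
    sinh x * (y ^ 2 - x ^ 2) ≤ 2 * x * (cosh y - cosh x) := by
  have hd : ∀ z, HasDerivAt (fun z => 2 * x * (cosh z - cosh x) - sinh x * (z ^ 2 - x ^ 2))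
      (2 * x * sinh z - sinh x * (2 * z)) z := by
    intro z
    have := (((hasDerivAt_cosh z).sub_const (cosh x)).const_mul (2 * x)).sub
      (((hasDerivAt_pow 2 z).sub_const (x ^ 2)).const_mul (sinh x))
    refine HasDerivAt.congr_deriv this ?_
    norm_num
  rcases le_total x y with h | h
  · have := mono_of_hasDeriv (a := x) (fun z _ => hd z) (fun z hz => ?_) x y le_rfl h
    · simp at this; linarith
    · have := sinh_div_mono hx hz
      rw [div_le_div_iff₀ hx (lt_of_lt_of_le hx hz)] at this
      nlinarith
  · have hanti : AntitoneOn (fun z => 2 * x * (cosh z - cosh x) - sinh x * (z ^ 2 - x ^ 2))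
        (Set.Icc 0 x) := by
      apply antitoneOn_of_deriv_nonpos (convex_Icc 0 x)
      · intro z _; exact (hd z).continuousAt.continuousWithinAt
      · intro z _; exact (hd z).differentiableAt.differentiableWithinAt
      · intro z hz
        rw [interior_Icc] at hz
        rw [(hd z).deriv]
        have := sinh_div_mono hz.1 hz.2.le
        rw [div_le_div_iff₀ hz.1 hx] at this
        nlinarith
    have := hanti ⟨hy, h⟩ ⟨hx.le, le_rfl⟩ h
    simp at this; linarith

/-- linear second order comparison -/
lemma ode_comp {κ : ℝ} (hκ : 0 < κ) {h h1 h2 : ℝ → ℝ} (hh : ∀ t, HasDerivAt h (h1 t) t)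
    (hh1 : ∀ t, HasDerivAt h1 (h2 t) t) (hle : ∀ t, h2 t ≤ κ ^ 2 * h t) {T : ℝ} (hT : 0 ≤ T) :
    h T ≤ h 0 * cosh (κ * T) + h1 0 * (sinh (κ * T) / κ) := by
  have dc : ∀ t, HasDerivAt (fun t => cosh (κ * t)) (κ * sinh (κ * t)) t := by
    intro t
    have := ((hasDerivAt_id t).const_mul κ).cosh
    simpa [mul_comm] using this
  have ds : ∀ t, HasDerivAt (fun t => sinh (κ * t)) (κ * cosh (κ * t)) t := by
    intro t
    have := ((hasDerivAt_id t).const_mul κ).sinh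
    simpa [mul_comm] using this
  have s1 : ∀ t, 0 ≤ t → h1 t * cosh (κ * t) - κ * (h t * sinh (κ * t)) ≤ h1 0 := by
    intro t ht
    have := mono_of_hasDeriv (a := 0)
      (F := fun t => - (h1 t * cosh (κ * t) - κ * (h t * sinh (κ * t))))
      (fun t _ => (((hh1 t).mul (dc t)).sub (((hh t).mul (ds t)).const_mul κ)).neg)
      (fun t _ => by
        have := mul_le_mul_of_nonneg_right (hle t) (cosh_pos (κ * t)).le
        linarith) 0 t le_rfl ht
    simp at this; linarith
  have s2 := mono_of_hasDeriv (a := 0)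
      (F := fun t => (h1 0 * (sinh (κ * t) / κ) - h t) / cosh (κ * t))
      (fun t _ => ((((ds t).div_const κ).const_mul (h1 0)).sub (hh t)).div (dc t)
        (cosh_pos (κ * t)).ne')
      (fun t ht => by
        apply div_nonneg _ (sq_nonneg _)
        have := s1 t ht
        have hc := cosh_sq (κ * t)
        have e1 : (h1 0 * (κ * cosh (κ * t) / κ) - h1 t) * cosh (κ * t)
            - (h1 0 * (sinh (κ * t) / κ) - h t) * (κ * sinh (κ * t))
            = h1 0 * (cosh (κ * t) ^ 2 - sinh (κ * t) ^ 2)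
              - (h1 t * cosh (κ * t) - κ * (h t * sinh (κ * t))) := by
          field_simp
          ring
        show 0 ≤ (h1 0 * (κ * cosh (κ * t) / κ) - h1 t) * cosh (κ * t)
            - (h1 0 * (sinh (κ * t) / κ) - h t) * (κ * sinh (κ * t))
        rw [e1, hc]
        linarith) 0 T le_rfl hT
  simp at s2
  rw [le_div_iff₀ (cosh_pos _)] at s2
  linarith

lemma scalar_comp {κ : ℝ} (hκ : 0 < κ) {y y1 y2 : ℝ → ℝ} (hy : ∀ t, HasDerivAt y (y1 t) t)
    (hy1 : ∀ t, HasDerivAt y1 (y2 t) t) (hpos : ∀ t, 0 < y t)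
    (hle : ∀ t, y2 t / 2 ≤ xcoth (κ * √(y t)) - (xcoth (κ * √(y t)) - 1) * ((y1 t / 2) ^ 2 / y t))
    {T : ℝ} (hT : 0 ≤ T) :
    y T ≤ y 0 + xcoth (κ * √(y 0)) / κ * (T * sinh (κ * T)) + y1 0 * (sinh (κ * T) / κ) := by
  have hs : ∀ t, 0 < √(y t) := fun t => Real.sqrt_pos.2 (hpos t)
  have hsq : ∀ t, √(y t) ^ 2 = y t := fun t => Real.sq_sqrt (hpos t).le
  have hd : ∀ t, HasDerivAt (fun t => √(y t)) (y1 t / (2 * √(y t))) t :=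
    fun t => (hy t).sqrt (hpos t).ne'
  have hh : ∀ t, HasDerivAt (fun t => cosh (κ * √(y t)))
      (sinh (κ * √(y t)) * (κ * (y1 t / (2 * √(y t))))) t := fun t => ((hd t).const_mul κ).cosh
  have hh1 : ∀ t, HasDerivAt (fun t => sinh (κ * √(y t)) * (κ * (y1 t / (2 * √(y t))))) _ t :=
    fun t => (((hd t).const_mul κ).sinh).mul
      (((hy1 t).div ((hd t).const_mul 2) (by have := hs t; positivity)).const_mul κ)
  have key := ode_comp hκ hh hh1 (fun t => ?_) hT
  · have hse : 0 < κ * √(y 0) := mul_pos hκ (hs 0)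
    have htan := cosh_tangent hse (mul_pos hκ (hs T)).le
    have hsp := sinh_pos_iff.2 hse
    have h2 := two_cosh_sub_one_le (mul_nonneg hκ.le hT)
    have he0 := hs 0
    have hc0 := cosh_pos (κ * √(y 0))
    rw [mul_pow, mul_pow, hsq, hsq] at htan
    unfold xcoth
    generalize √(y 0) = e at *
    generalize cosh (κ * e) = c at *
    generalize sinh (κ * e) = s at *
    have k1 : s * κ ^ 2 * (y T - y 0)
        ≤ 2 * κ * e * (c * (cosh (κ * T) - 1) + s * (y1 0 / (2 * e)) * sinh (κ * T)) := by
      have e1 : s * (κ * (y1 0 / (2 * e))) * (sinh (κ * T) / κ)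
          = s * (y1 0 / (2 * e)) * sinh (κ * T) := by field_simp
      rw [e1] at key
      have := mul_le_mul_of_nonneg_left key (by positivity : 0 ≤ 2 * κ * e)
      nlinarith
    have k2 : s * κ ^ 2 * (y T - y 0)
        ≤ s * κ ^ 2 * (κ * e * c / s / κ * (T * sinh (κ * T)) + y1 0 * (sinh (κ * T) / κ)) := by
      have e2 : s * κ ^ 2 * (κ * e * c / s / κ * (T * sinh (κ * T)) + y1 0 * (sinh (κ * T) / κ))
        = κ * e * c * (κ * T * sinh (κ * T)) + κ * s * y1 0 * sinh (κ * T) := by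
        field_simp
      have e3 : 2 * κ * e * (c * (cosh (κ * T) - 1) + s * (y1 0 / (2 * e)) * sinh (κ * T))
        = κ * e * c * (2 * (cosh (κ * T) - 1)) + κ * s * y1 0 * sinh (κ * T) := by
        field_simp
      rw [e2]
      rw [e3] at k1
      have := mul_le_mul_of_nonneg_left h2 (by positivity : 0 ≤ κ * e * c)
      linarith
    have := le_of_mul_le_mul_left k2 (by positivity)
    linarith
  · have he := hs t
    have hse : 0 < sinh (κ * √(y t)) := sinh_pos_iff.2 (mul_pos hκ he)
    have hl := hle t
    have hq : (y1 t / 2) ^ 2 / y t = (y1 t / (2 * √(y t))) ^ 2 := by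
      nth_rewrite 1 [← hsq t]
      field_simp
    rw [hq] at hl
    unfold xcoth at hl
    generalize √(y t) = e at *
    generalize cosh (κ * e) = c at *
    generalize sinh (κ * e) = s at *
    have e1 : c * (κ * (y1 t / (2 * e))) * (κ * (y1 t / (2 * e))) +
      s * (κ * ((y2 t * (2 * e) - y1 t * (2 * (y1 t / (2 * e)))) / (2 * e) ^ 2))
      = κ ^ 2 * c * (y1 t / (2 * e)) ^ 2 + s * κ / e * (y2 t / 2 - (y1 t / (2 * e)) ^ 2) := by
      field_simp
    rw [e1]
    have h3 := mul_le_mul_of_nonneg_left hl (by positivity : 0 ≤ s * κ / e)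
    have e2 : s * κ / e * (κ * e * c / s - (κ * e * c / s - 1) * (y1 t / (2 * e)) ^ 2)
      = κ ^ 2 * c * (1 - (y1 t / (2 * e)) ^ 2) + s * κ / e * (y1 t / (2 * e)) ^ 2 := by
      field_simp
      ring
    rw [e2] at h3
    linarith


open SPD

variable {n : ℕ}

lemma mfun_diag_exists {A : Matrix (Fin n) (Fin n) ℝ} (hA : A.IsHermitian) :
    ∃ U : Matrix (Fin n) (Fin n) ℝ, Uᵀ * U = 1 ∧ U * Uᵀ = 1 ∧
      A = U * diagonal (eigs A) * Uᵀ ∧ ∀ f : ℝ → ℝ, mfun A f = U * diagonal (f ∘ eigs A) * Uᵀ := by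
  refine ⟨(hA.eigenvectorUnitary : Matrix (Fin n) (Fin n) ℝ), ?_, ?_, ?_, ?_⟩
  · have := Unitary.coe_star_mul_self hA.eigenvectorUnitary
    rwa [star_eq_conjTranspose, conjTranspose_eq_transpose_of_trivial] at this
  · have := Unitary.coe_mul_star_self hA.eigenvectorUnitary
    rwa [Unitary.coe_star, star_eq_conjTranspose, conjTranspose_eq_transpose_of_trivial] at this
  · have := hA.spectral_theorem
    rw [Unitary.conjStarAlgAut_apply, star_eq_conjTranspose,
      conjTranspose_eq_transpose_of_trivial] at this
    have e : eigs A = hA.eigenvalues := by simp only [eigs, hA, dif_pos]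
    rw [e]
    exact this
  · intro f
    simp only [mfun, eigs, hA, dif_pos]
    unfold Matrix.IsHermitian.cfc
    rw [Unitary.conjStarAlgAut_apply, star_eq_conjTranspose,
      conjTranspose_eq_transpose_of_trivial]
    rfl

lemma conj_entry (U V : Matrix (Fin n) (Fin n) ℝ) (a : Fin n → ℝ) (i j : Fin n) :
    (U * diagonal a * V) i j = ∑ k, U i k * a k * V k j := by
  rw [mul_apply]; simp [mul_diagonal]

lemma diag_isHermitian (U : Matrix (Fin n) (Fin n) ℝ) (a : Fin n → ℝ) :
    (U * diagonal a * Uᵀ).IsHermitian := by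
  unfold IsHermitian
  rw [conjTranspose_eq_transpose_of_trivial]
  simp [transpose_mul, mul_assoc]

/-- Intertwining: if `A X = X B` then `f(A) X = X f(B)`. -/
lemma diag_intertwine {U V : Matrix (Fin n) (Fin n) ℝ} {a b : Fin n → ℝ}
    (hU : Uᵀ * U = 1) (hU' : U * Uᵀ = 1) (hV : Vᵀ * V = 1) (hV' : V * Vᵀ = 1)
    {X : Matrix (Fin n) (Fin n) ℝ}
    (h : (U * diagonal a * Uᵀ) * X = X * (V * diagonal b * Vᵀ)) (f : ℝ → ℝ) :
    (U * diagonal (f ∘ a) * Uᵀ) * X = X * (V * diagonal (f ∘ b) * Vᵀ) := by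
  have h1 : diagonal a * (Uᵀ * X * V) = (Uᵀ * X * V) * diagonal b := by
    calc diagonal a * (Uᵀ * X * V) = (Uᵀ * U) * diagonal a * (Uᵀ * X * V) := by rw [hU, one_mul]
      _ = Uᵀ * ((U * diagonal a * Uᵀ) * X) * V := by simp only [mul_assoc]
      _ = Uᵀ * X * V * diagonal b * (Vᵀ * V) := by rw [h]; simp only [mul_assoc]
      _ = _ := by rw [hV, mul_one]
  have h2 : diagonal (f ∘ a) * (Uᵀ * X * V) = (Uᵀ * X * V) * diagonal (f ∘ b) := by
    ext i j
    have := congrFun (congrFun h1 i) j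
    rw [diagonal_mul, mul_diagonal] at this ⊢
    by_cases hz : (Uᵀ * X * V) i j = 0
    · rw [hz]; simp
    · have hab : a i = b j := by
        rw [mul_comm] at this
        exact mul_left_cancel₀ hz this
      simp [hab, mul_comm]
  calc (U * diagonal (f ∘ a) * Uᵀ) * X
      = U * (diagonal (f ∘ a) * (Uᵀ * X * V)) * Vᵀ := by
        simp only [mul_assoc]; rw [hV', mul_one]
    _ = (U * Uᵀ) * X * V * diagonal (f ∘ b) * Vᵀ := by rw [h2]; simp only [mul_assoc]
    _ = _ := by rw [hU', one_mul]; simp only [mul_assoc]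

lemma mfun_intertwine {A B X : Matrix (Fin n) (Fin n) ℝ} (hA : A.IsHermitian) (hB : B.IsHermitian)
    (h : A * X = X * B) (f : ℝ → ℝ) : mfun A f * X = X * mfun B f := by
  obtain ⟨U, hU, hU', eA, fA⟩ := mfun_diag_exists hA
  obtain ⟨V, hV, hV', eB, fB⟩ := mfun_diag_exists hB
  rw [fA, fB]
  apply diag_intertwine hU hU' hV hV'
  rw [← eA, ← eB, h]

lemma mfun_of_diag {V : Matrix (Fin n) (Fin n) ℝ} {b : Fin n → ℝ} (hV : Vᵀ * V = 1) (f : ℝ → ℝ) :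
    mfun (V * diagonal b * Vᵀ) f = V * diagonal (f ∘ b) * Vᵀ := by
  have hV' : V * Vᵀ = 1 := mul_eq_one_comm.1 hV
  obtain ⟨U, hU, hU', eA, fA⟩ := mfun_diag_exists (diag_isHermitian V b)
  have := diag_intertwine (X := 1) hU hU' hV hV' (by rw [← eA, mul_one, one_mul]) f
  rw [mul_one, one_mul] at this
  rw [fA, this]

lemma trace_diag_conj {V : Matrix (Fin n) (Fin n) ℝ} {b : Fin n → ℝ} (hV : Vᵀ * V = 1) :
    (V * diagonal b * Vᵀ).trace = ∑ i, b i := by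
  rw [trace_mul_comm, ← mul_assoc, hV, one_mul, trace_diagonal]

lemma diag_conj_mul {V : Matrix (Fin n) (Fin n) ℝ} {a b : Fin n → ℝ} (hV : Vᵀ * V = 1) :
    (V * diagonal a * Vᵀ) * (V * diagonal b * Vᵀ) = V * diagonal (fun i => a i * b i) * Vᵀ := by
  calc _ = V * diagonal a * (Vᵀ * V) * diagonal b * Vᵀ := by simp only [mul_assoc]
    _ = _ := by rw [hV, mul_one, mul_assoc V, diagonal_mul_diagonal]

lemma sum_eigs {A : Matrix (Fin n) (Fin n) ℝ} (hA : A.IsHermitian) (f : ℝ → ℝ) :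
    (mfun A f * mfun A f).trace = ∑ i, (f (eigs A i)) ^ 2 := by
  obtain ⟨U, hU, hU', eA, fA⟩ := mfun_diag_exists hA
  rw [fA, diag_conj_mul hU, trace_diag_conj hU]
  simp [sq]

lemma mfun_isHermitian {A : Matrix (Fin n) (Fin n) ℝ} (hA : A.IsHermitian) (f : ℝ → ℝ) :
    (mfun A f).IsHermitian := by
  obtain ⟨U, hU, hU', eA, fA⟩ := mfun_diag_exists hA
  rw [fA]; exact diag_isHermitian _ _

lemma eigs_pos {A : Matrix (Fin n) (Fin n) ℝ} (hA : A.PosDef) (i : Fin n) : 0 < eigs A i := by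
  simp only [eigs, hA.1, dif_pos]
  exact hA.eigenvalues_pos i

lemma diag_conj_inv {V : Matrix (Fin n) (Fin n) ℝ} {b : Fin n → ℝ} (hV : Vᵀ * V = 1)
    (hb : ∀ i, b i ≠ 0) :
    (V * diagonal b * Vᵀ)⁻¹ = V * diagonal (fun i => (b i)⁻¹) * Vᵀ := by
  apply inv_eq_right_inv
  rw [diag_conj_mul hV]
  have : (fun i => b i * (b i)⁻¹) = fun _ => 1 := by ext i; exact mul_inv_cancel₀ (hb i)
  rw [this, diagonal_one, mul_one]
  exact mul_eq_one_comm.1 hV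

lemma diag_conj_posDef {N : Matrix (Fin n) (Fin n) ℝ} (hN : IsUnit N) {a : Fin n → ℝ}
    (ha : ∀ i, 0 < a i) : (N * diagonal a * Nᵀ).PosDef := by
  have h1 : (diagonal a).PosDef := Matrix.PosDef.diagonal ha
  have := (Matrix.IsUnit.posDef_star_right_conjugate_iff hN).2 h1
  rwa [star_eq_conjTranspose, conjTranspose_eq_transpose_of_trivial] at this

/-- Divided difference of the logarithm. -/
noncomputable def fd (a b : ℝ) : ℝ := if a = b then a⁻¹ else (log a - log b) / (a - b)

lemma abs_log_sub {x a : ℝ} (hx : 0 < x) (ha : 0 < a) :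
    |log x - log a| ≤ (x⁻¹ + a⁻¹) * |x - a| := by
  have h1 : log x - log a ≤ (x - a) * a⁻¹ := by
    rw [← Real.log_div hx.ne' ha.ne']
    have := Real.log_le_sub_one_of_pos (div_pos hx ha)
    have e : x / a - 1 = (x - a) * a⁻¹ := by field_simp
    linarith
  have h2 : log a - log x ≤ (a - x) * x⁻¹ := by
    rw [← Real.log_div ha.ne' hx.ne']
    have := Real.log_le_sub_one_of_pos (div_pos ha hx)
    have e : a / x - 1 = (a - x) * x⁻¹ := by field_simp
    linarith
  have hx' := inv_pos.2 hx
  have ha' := inv_pos.2 ha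
  have h3 := le_abs_self (x - a)
  have h4 := neg_abs_le (x - a)
  have h5 := abs_nonneg (x - a)
  rw [abs_le]
  constructor <;> nlinarith

lemma fd_bound {a b R : ℝ} (ha : 0 < a) (hb : 0 < b) :
    ∃ K, 0 ≤ K ∧ ∀ x, 0 < x → x⁻¹ ≤ R →
      |log x - log a - fd a b * (x - a)| ≤ K * (|x - a| * |x - b|) := by
  by_cases hab : a = b
  · subst hab
    refine ⟨a⁻¹ * |R|, by positivity, fun x hx hR => ?_⟩
    have h1 : log x - log a ≤ (x - a) * a⁻¹ := by
      rw [← Real.log_div hx.ne' ha.ne']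
      have := Real.log_le_sub_one_of_pos (div_pos hx ha)
      have e : x / a - 1 = (x - a) * a⁻¹ := by field_simp
      linarith
    have h2 : log a - log x ≤ (a - x) * x⁻¹ := by
      rw [← Real.log_div ha.ne' hx.ne']
      have := Real.log_le_sub_one_of_pos (div_pos ha hx)
      have e : a / x - 1 = (a - x) * x⁻¹ := by field_simp
      linarith
    have e : (x - a) * a⁻¹ + (a - x) * x⁻¹ = a⁻¹ * x⁻¹ * (x - a) ^ 2 := by
      field_simp; ring
    rw [fd, if_pos rfl, abs_of_nonpos (by linarith), ← abs_mul, ← sq, abs_of_nonneg (sq_nonneg (x - a))]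
    have : a⁻¹ * x⁻¹ * (x - a) ^ 2 ≤ a⁻¹ * |R| * (x - a) ^ 2 := by
      have := le_trans hR (le_abs_self R)
      gcongr
    linarith
  · have hd : 0 < |a - b| := abs_pos.2 (sub_ne_zero.2 hab)
    set K0 := |R| + a⁻¹ + b⁻¹ + |fd a b| with hK0
    have hK0n : 0 ≤ K0 := by positivity
    refine ⟨K0 * (2 / |a - b|), by positivity, fun x hx hR => ?_⟩
    have hfd : fd a b * (a - b) = log a - log b := by
      rw [fd, if_neg hab]; exact div_mul_cancel₀ _ (sub_ne_zero.2 hab)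
    have hR' := le_trans hR (le_abs_self R)
    have ha' := inv_pos.2 ha
    have hb' := inv_pos.2 hb
    have r1 : |log x - log a - fd a b * (x - a)| ≤ K0 * |x - a| := by
      calc _ ≤ |log x - log a| + |fd a b * (x - a)| := abs_sub _ _
        _ ≤ (x⁻¹ + a⁻¹) * |x - a| + |fd a b| * |x - a| := by
          rw [abs_mul]; linarith [abs_log_sub hx ha]
        _ ≤ K0 * |x - a| := by
          rw [← add_mul]; gcongr; rw [hK0]; linarith
    have r2 : |log x - log a - fd a b * (x - a)| ≤ K0 * |x - b| := by
      have e : log x - log a - fd a b * (x - a) = log x - log b - fd a b * (x - b) := by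
        linarith
      rw [e]
      calc _ ≤ |log x - log b| + |fd a b * (x - b)| := abs_sub _ _
        _ ≤ (x⁻¹ + b⁻¹) * |x - b| + |fd a b| * |x - b| := by
          rw [abs_mul]; linarith [abs_log_sub hx hb]
        _ ≤ K0 * |x - b| := by
          rw [← add_mul]; gcongr; rw [hK0]; linarith
    have htri : |a - b| ≤ |x - a| + |x - b| := by
      have := abs_sub_le a x b
      rwa [abs_sub_comm a x] at this
    rcases le_total |x - a| |x - b| with h | h
    · have h1 : 1 ≤ 2 / |a - b| * |x - b| := by
        rw [div_mul_eq_mul_div, le_div_iff₀ hd]; linarith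
      calc _ ≤ K0 * |x - a| * 1 := by rw [mul_one]; exact r1
        _ ≤ K0 * |x - a| * (2 / |a - b| * |x - b|) := by gcongr
        _ = _ := by ring
    · have h1 : 1 ≤ 2 / |a - b| * |x - a| := by
        rw [div_mul_eq_mul_div, le_div_iff₀ hd]; linarith
      calc _ ≤ K0 * |x - b| * 1 := by rw [mul_one]; exact r2
        _ ≤ K0 * |x - b| * (2 / |a - b| * |x - a|) := by gcongr
        _ = _ := by ring

lemma sum_sq_eq_trace (G : Matrix (Fin n) (Fin n) ℝ) :
    ∑ k, ∑ l, G k l ^ 2 = (G * Gᵀ).trace := by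
  simp [trace, mul_apply, sq]

lemma sum_sq_conj {U V : Matrix (Fin n) (Fin n) ℝ} (hU' : U * Uᵀ = 1) (hV' : V * Vᵀ = 1)
    (X : Matrix (Fin n) (Fin n) ℝ) :
    ∑ k, ∑ l, (Uᵀ * X * V) k l ^ 2 = ∑ k, ∑ l, X k l ^ 2 := by
  rw [sum_sq_eq_trace, sum_sq_eq_trace]
  have : Uᵀ * X * V * (Uᵀ * X * V)ᵀ = Uᵀ * (X * Xᵀ * U) := by
    simp only [transpose_mul, transpose_transpose]
    calc _ = Uᵀ * X * (V * Vᵀ) * Xᵀ * U := by simp only [mul_assoc]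
      _ = _ := by rw [hV']; simp only [mul_assoc, mul_one]
  rw [this, trace_mul_comm, mul_assoc, hU', mul_one]

lemma log_pert {V : Matrix (Fin n) (Fin n) ℝ} {b : Fin n → ℝ} (hV : Vᵀ * V = 1)
    (hb : ∀ i, 0 < b i) (R : ℝ) (i j : Fin n) :
    ∃ K, 0 ≤ K ∧ ∀ A : Matrix (Fin n) (Fin n) ℝ, A.PosDef → A⁻¹.trace ≤ R →
      |((Vᵀ * mfun A log * V) i j - fd (b i) (b j) * (Vᵀ * A * V) i j)
        - ((Vᵀ * mfun (V * diagonal b * Vᵀ) log * V) i j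
            - fd (b i) (b j) * (Vᵀ * (V * diagonal b * Vᵀ) * V) i j)|
      ≤ K * ∑ k, ∑ l, (A - V * diagonal b * Vᵀ) k l ^ 2 := by
  have hV' : V * Vᵀ = 1 := mul_eq_one_comm.1 hV
  obtain ⟨K, hK0, hK⟩ := fd_bound (R := R) (hb i) (hb j)
  refine ⟨2 * K, by positivity, fun A hA hR => ?_⟩
  obtain ⟨U, hU, hU', eA, fA⟩ := mfun_diag_exists hA.1
  have hpos := eigs_pos hA
  set α := eigs A with hα
  have hinv : ∀ k, (α k)⁻¹ ≤ R := by
    intro k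
    have h1 : A⁻¹.trace = ∑ k, (α k)⁻¹ := by
      rw [eA, diag_conj_inv hU (fun i => (hpos i).ne'), trace_diag_conj hU]
    refine le_trans ?_ (h1 ▸ hR)
    exact Finset.single_le_sum (f := fun k => (α k)⁻¹) (fun k _ => (inv_pos.2 (hpos k)).le)
      (Finset.mem_univ k)
  set Q := Uᵀ * V with hQ
  have hQQ : Qᵀ * Q = 1 := by
    rw [hQ, transpose_mul, transpose_transpose]
    calc _ = Vᵀ * (U * Uᵀ) * V := by simp only [mul_assoc]
      _ = 1 := by rw [hU', mul_one, hV]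
  have cQ : ∀ a : Fin n → ℝ, (Vᵀ * (U * diagonal a * Uᵀ) * V) i j = ∑ k, Q k i * a k * Q k j := by
    intro a
    have : Vᵀ * (U * diagonal a * Uᵀ) * V = Qᵀ * diagonal a * Q := by
      rw [hQ, transpose_mul, transpose_transpose]; simp only [mul_assoc]
    rw [this, conj_entry]; simp
  have cV : ∀ a : Fin n → ℝ, (Vᵀ * (V * diagonal a * Vᵀ) * V) i j = a i * ∑ k, Q k i * Q k j := by
    intro a
    have h1 : Vᵀ * (V * diagonal a * Vᵀ) * V = diagonal a * (Qᵀ * Q) := by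
      rw [hQQ]
      calc _ = (Vᵀ * V) * diagonal a * (Vᵀ * V) := by simp only [mul_assoc]
        _ = _ := by rw [hV, one_mul]
    rw [h1, diagonal_mul, mul_apply]; simp
  have hG : ∀ k l, (Uᵀ * (A - V * diagonal b * Vᵀ) * V) k l = (α k - b l) * Q k l := by
    intro k l
    have : Uᵀ * (A - V * diagonal b * Vᵀ) * V = diagonal α * Q - Q * diagonal b := by
      rw [mul_sub, sub_mul, hQ]
      congr 1
      · rw [eA]
        calc _ = (Uᵀ * U) * diagonal α * (Uᵀ * V) := by simp only [mul_assoc]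
          _ = _ := by rw [hU, one_mul]
      · calc _ = (Uᵀ * V) * diagonal b * (Vᵀ * V) := by simp only [mul_assoc]
          _ = _ := by rw [hV, mul_one]
    rw [this, Matrix.sub_apply, diagonal_mul, mul_diagonal]; ring
  have e1 : ((Vᵀ * mfun A log * V) i j - fd (b i) (b j) * (Vᵀ * A * V) i j)
        - ((Vᵀ * mfun (V * diagonal b * Vᵀ) log * V) i j
            - fd (b i) (b j) * (Vᵀ * (V * diagonal b * Vᵀ) * V) i j)
      = ∑ k, (log (α k) - log (b i) - fd (b i) (b j) * (α k - b i)) * (Q k i * Q k j) := by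
    have hAd : (Vᵀ * A * V) i j = ∑ k, Q k i * α k * Q k j := by
      rw [← cQ, ← eA]
    rw [fA, mfun_of_diag hV, cQ, hAd, cV, cV]
    simp only [Finset.mul_sum, ← Finset.sum_sub_distrib]
    apply Finset.sum_congr rfl
    intro k _
    simp only [Function.comp_apply]
    ring
  rw [e1, ← sum_sq_conj hU' hV']
  calc |∑ k, (log (α k) - log (b i) - fd (b i) (b j) * (α k - b i)) * (Q k i * Q k j)|
      ≤ ∑ k, |(log (α k) - log (b i) - fd (b i) (b j) * (α k - b i)) * (Q k i * Q k j)| :=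
        Finset.abs_sum_le_sum_abs _ _
    _ ≤ ∑ k, 2 * K * ∑ l, (Uᵀ * (A - V * diagonal b * Vᵀ) * V) k l ^ 2 := by
        apply Finset.sum_le_sum
        intro k _
        have h1 := hK (α k) (hpos k) (hinv k)
        have hi : (Uᵀ * (A - V * diagonal b * Vᵀ) * V) k i ^ 2
            ≤ ∑ l, (Uᵀ * (A - V * diagonal b * Vᵀ) * V) k l ^ 2 :=
          Finset.single_le_sum (f := fun l => (Uᵀ * (A - V * diagonal b * Vᵀ) * V) k l ^ 2)
            (fun l _ => sq_nonneg _) (Finset.mem_univ i)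
        have hj : (Uᵀ * (A - V * diagonal b * Vᵀ) * V) k j ^ 2
            ≤ ∑ l, (Uᵀ * (A - V * diagonal b * Vᵀ) * V) k l ^ 2 :=
          Finset.single_le_sum (f := fun l => (Uᵀ * (A - V * diagonal b * Vᵀ) * V) k l ^ 2)
            (fun l _ => sq_nonneg _) (Finset.mem_univ j)
        set Sg := ∑ l, (Uᵀ * (A - V * diagonal b * Vᵀ) * V) k l ^ 2
        rw [hG] at hi hj
        rw [abs_mul]
        calc _ ≤ K * (|α k - b i| * |α k - b j|) * |Q k i * Q k j| := by gcongr
          _ = K * (|(α k - b i) * Q k i| * |(α k - b j) * Q k j|) := by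
            simp only [abs_mul]; ring
          _ ≤ K * (2 * Sg) := by
            refine mul_le_mul_of_nonneg_left ?_ hK0
            rw [← sq_abs] at hi hj
            nlinarith [sq_nonneg (|(α k - b i) * Q k i| - |(α k - b j) * Q k j|),
              sq_nonneg (|(α k - b i) * Q k i|), sq_nonneg (|(α k - b j) * Q k j|)]
          _ = _ := by ring
    _ = _ := by rw [Finset.mul_sum]

lemma hasDerivAt_of_bound {F S : ℝ → ℝ} {t : ℝ} {K : ℝ} (hS : HasDerivAt S 0 t) (hS0 : S t = 0)
    (h : ∀ᶠ s in nhds t, |F s - F t| ≤ K * S s) : HasDerivAt F 0 t := by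
  rw [hasDerivAt_iff_isLittleO] at hS ⊢
  simp only [hS0, smul_zero, sub_zero] at hS ⊢
  refine Asymptotics.IsBigO.trans_isLittleO (Asymptotics.IsBigO.of_bound |K| ?_) hS
  filter_upwards [h] with s hs
  rw [Real.norm_eq_abs, Real.norm_eq_abs, ← abs_mul]
  exact le_trans hs (le_abs_self _)

lemma log_hasDerivAt {A : ℝ → Matrix (Fin n) (Fin n) ℝ} {A1 : Matrix (Fin n) (Fin n) ℝ} {t : ℝ}
    (hpos : ∀ s, (A s).PosDef) (hd : ∀ i j, HasDerivAt (fun s => A s i j) (A1 i j) t)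
    (hc : ContinuousAt (fun s => (A s)⁻¹.trace) t)
    {V : Matrix (Fin n) (Fin n) ℝ} {b : Fin n → ℝ} (hV : Vᵀ * V = 1)
    (hb : ∀ i, 0 < b i) (hA : A t = V * diagonal b * Vᵀ) (i j : Fin n) :
    HasDerivAt (fun s => (Vᵀ * mfun (A s) log * V) i j)
      (fd (b i) (b j) * (Vᵀ * A1 * V) i j) t := by
  obtain ⟨K, hK0, hK⟩ := log_pert hV hb ((A t)⁻¹.trace + 1) i j
  rw [← hA] at hK
  have hR : ∀ᶠ s in nhds t, (A s)⁻¹.trace ≤ (A t)⁻¹.trace + 1 := by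
    have := hc.eventually (gt_mem_nhds (show (A t)⁻¹.trace < (A t)⁻¹.trace + 1 by linarith))
    filter_upwards [this] with s hs using le_of_lt hs
  have hS : HasDerivAt (fun s => ∑ k, ∑ l, (A s - A t) k l ^ 2) 0 t := by
    have : HasDerivAt (fun s => ∑ k, ∑ l, (A s k l - A t k l) ^ 2)
        (∑ k, ∑ l, (2 : ℕ) * (A t k l - A t k l) ^ (2 - 1) * A1 k l) t := by
      apply HasDerivAt.fun_sum; intro k _
      apply HasDerivAt.fun_sum; intro l _
      exact ((hd k l).sub_const _).fun_pow 2
    simpa using this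
  have hF := hasDerivAt_of_bound
    (F := fun s => (Vᵀ * mfun (A s) log * V) i j - fd (b i) (b j) * (Vᵀ * A s * V) i j)
    hS (by simp) (K := K) (by
      filter_upwards [hR] with s hs using hK (A s) (hpos s) hs)
  have hM : HasDerivAt (fun s => (Vᵀ * A s * V) i j) ((Vᵀ * A1 * V) i j) t := by
    simp only [mul_apply]
    apply HasDerivAt.fun_sum; intro k _
    apply HasDerivAt.mul_const
    apply HasDerivAt.fun_sum; intro l _
    exact (hd l k).const_mul _
  have := hF.add (hM.const_mul (fd (b i) (b j)))
  rw [zero_add] at this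
  refine this.congr_of_eventuallyEq (Filter.Eventually.of_forall fun s => ?_)
  simp

lemma khat_pos : 0 < khat := by unfold khat; positivity

lemma khat_sq : khat ^ 2 = 1 / 2 := by
  unfold khat; rw [inv_pow, Real.sq_sqrt (by norm_num)]; norm_num

lemma chi_eq {a b : ℝ} (ha : 0 < a) (hb : 0 < b) (hab : a ≠ b) :
    (a + b) / 2 * fd a b = xcoth ((log a - log b) / 2) := by
  rw [fd, if_neg hab, xcoth]
  set z := (log a - log b) / 2 with hz
  set m := (log a + log b) / 2 with hm
  have h1 : exp m * exp z = a := by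
    rw [← Real.exp_add, hm, hz]
    ring_nf
    exact Real.exp_log ha
  have h2 : exp m * exp (-z) = b := by
    rw [← Real.exp_add, hm, hz]
    ring_nf
    exact Real.exp_log hb
  have h3 : a + b = 2 * exp m * cosh z := by
    rw [Real.cosh_eq, ← h1, ← h2]; ring
  have h4 : a - b = 2 * exp m * sinh z := by
    rw [Real.sinh_eq, ← h1, ← h2]; ring
  have h5 : log a - log b = 2 * z := by rw [hz]; ring
  have h6 : sinh z ≠ 0 := by
    intro h
    rw [h, mul_zero] at h4
    exact hab (sub_eq_zero.1 h4)
  have h7 := (Real.exp_pos m).ne'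
  rw [h3, h4, h5]
  field_simp

lemma chi_eq_one {a : ℝ} (ha : 0 < a) : (a + a) / 2 * fd a a = 1 := by
  rw [fd, if_pos rfl]; field_simp; ring

lemma one_le_chi {a b : ℝ} (ha : 0 < a) (hb : 0 < b) : 1 ≤ (a + b) / 2 * fd a b := by
  by_cases hab : a = b
  · subst hab; rw [chi_eq_one ha]
  · rw [chi_eq ha hb hab]
    have hne : (log a - log b) / 2 ≠ 0 := by
      intro h
      exact hab (Real.log_injOn_pos ha hb (by linarith))
    rcases lt_or_gt_of_ne hne with h | h
    · rw [← xcoth_neg]; exact one_le_xcoth (by linarith)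
    · exact one_le_xcoth h

lemma chi_le {a b e : ℝ} (ha : 0 < a) (hb : 0 < b) (he : 0 < e)
    (h : log a ^ 2 + log b ^ 2 ≤ e ^ 2) : (a + b) / 2 * fd a b ≤ xcoth (khat * e) := by
  have hke := mul_pos khat_pos he
  by_cases hab : a = b
  · subst hab; rw [chi_eq_one ha]; exact one_le_xcoth hke
  · rw [chi_eq ha hb hab]
    have hz : |(log a - log b) / 2| ≤ khat * e := by
      apply abs_le_of_sq_le_sq _ hke.le
      rw [mul_pow, khat_sq]
      nlinarith [sq_nonneg (log a + log b)]
    have hne : (log a - log b) / 2 ≠ 0 := by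
      intro h
      exact hab (Real.log_injOn_pos ha hb (by linarith))
    rw [abs_le] at hz
    rcases lt_or_gt_of_ne hne with h | h
    · rw [← xcoth_neg]; exact xcoth_mono (by linarith) (by linarith)
    · exact xcoth_mono h hz.2

/-- `A(s) = N diag(e^{s w}) Nᵀ`. -/
noncomputable def crv (N : Matrix (Fin n) (Fin n) ℝ) (w : Fin n → ℝ) (s : ℝ) :
    Matrix (Fin n) (Fin n) ℝ := N * diagonal (fun i => exp (s * w i)) * Nᵀ

noncomputable def G0 (N : Matrix (Fin n) (Fin n) ℝ) (w : Fin n → ℝ) (s : ℝ) : ℝ :=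
  (mfun (crv N w s) log * mfun (crv N w s) log).trace

noncomputable def G1 (N : Matrix (Fin n) (Fin n) ℝ) (w : Fin n → ℝ) (s : ℝ) : ℝ :=
  2 * (mfun (crv N w s) log * (N⁻¹ᵀ * diagonal w * Nᵀ)).trace

lemma trace_conj_mul {V : Matrix (Fin n) (Fin n) ℝ} (hV' : V * Vᵀ = 1)
    (X Y : Matrix (Fin n) (Fin n) ℝ) :
    (X * Y).trace = ∑ i, ∑ j, (Vᵀ * X * V) i j * (Vᵀ * Y * V) j i := by
  have h : ∀ P Q : Matrix (Fin n) (Fin n) ℝ, (P * Q).trace = ∑ i, ∑ j, P i j * Q j i := by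
    intro P Q; simp [trace, mul_apply]
  rw [← h]
  have : Vᵀ * X * V * (Vᵀ * Y * V) = Vᵀ * (X * Y * V) := by
    calc _ = Vᵀ * X * (V * Vᵀ) * Y * V := by simp only [mul_assoc]
      _ = _ := by rw [hV']; simp only [mul_assoc, mul_one]
  rw [this, trace_mul_comm Vᵀ, mul_assoc (X * Y), hV', mul_one]

lemma crv_posDef {N : Matrix (Fin n) (Fin n) ℝ} (hN : IsUnit N) (w : Fin n → ℝ) (s : ℝ) :
    (crv N w s).PosDef := diag_conj_posDef hN (fun _ => Real.exp_pos _)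

lemma core {N : Matrix (Fin n) (Fin n) ℝ} (hN : IsUnit N) (w : Fin n → ℝ) (t : ℝ) :
    HasDerivAt (G0 N w) (G1 N w t) t ∧ ∃ g2, HasDerivAt (G1 N w) g2 t ∧ ∑ i, w i ^ 2 ≤ g2 / 2 ∧
      ∀ e, 0 < e → G0 N w t ≤ e ^ 2 →
        g2 / 2 ≤ xcoth (khat * e) * ∑ i, w i ^ 2
          - (xcoth (khat * e) - 1) * ((G1 N w t / 2) ^ 2 / e ^ 2) := by
  have hdet : IsUnit N.det := (Matrix.isUnit_iff_isUnit_det N).1 hN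
  have hNN : N * N⁻¹ = 1 := mul_nonsing_inv _ hdet
  have hNN' : N⁻¹ * N = 1 := nonsing_inv_mul _ hdet
  have hTT : Nᵀ * N⁻¹ᵀ = 1 := by rw [← transpose_mul, hNN', transpose_one]
  have hTT' : N⁻¹ᵀ * Nᵀ = 1 := by rw [← transpose_mul, hNN, transpose_one]
  have hpd := crv_posDef hN w
  obtain ⟨V, hV, hV', eA, fA⟩ := mfun_diag_exists (hpd t).1
  have hb := eigs_pos (hpd t)
  set b := eigs (crv N w t) with hbdef
  set A1 := N * diagonal (fun i => w i * exp (t * w i)) * Nᵀ with hA1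
  set B := N⁻¹ᵀ * diagonal w * Nᵀ with hB
  have hd : ∀ i j, HasDerivAt (fun s => crv N w s i j) (A1 i j) t := by
    intro i j
    simp only [crv, hA1, conj_entry]
    apply HasDerivAt.fun_sum; intro k _
    apply HasDerivAt.mul_const
    apply HasDerivAt.const_mul
    have := ((hasDerivAt_id t).mul_const (w k)).exp
    simpa [mul_comm] using this
  have hinv : ∀ s, (crv N w s)⁻¹ = N⁻¹ᵀ * diagonal (fun i => exp (-(s * w i))) * N⁻¹ := by
    intro s
    apply inv_eq_right_inv
    unfold crv
    calc _ = N * diagonal (fun i => exp (s * w i)) * (Nᵀ * N⁻¹ᵀ) *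
          diagonal (fun i => exp (-(s * w i))) * N⁻¹ := by simp only [mul_assoc]
      _ = N * (diagonal (fun i => exp (s * w i)) * diagonal (fun i => exp (-(s * w i)))) * N⁻¹ := by
        rw [hTT, mul_one]; simp only [mul_assoc]
      _ = 1 := by
        rw [diagonal_mul_diagonal]
        have : (fun i => exp (s * w i) * exp (-(s * w i))) = fun _ => (1 : ℝ) := by
          ext i; rw [← Real.exp_add]; simp
        rw [this, diagonal_one, mul_one, hNN]
  have hc : ContinuousAt (fun s => (crv N w s)⁻¹.trace) t := by
    simp only [hinv, trace, diag_apply, conj_entry]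
    apply Continuous.continuousAt
    fun_prop
  have hL := log_hasDerivAt hpd hd hc hV hb eA
  set S := Vᵀ * A1 * V with hS
  have hAB : crv N w t * B = A1 := by
    rw [crv, hB, hA1]
    calc _ = N * diagonal (fun i => exp (t * w i)) * (Nᵀ * N⁻¹ᵀ) * diagonal w * Nᵀ := by
          simp only [mul_assoc]
      _ = N * (diagonal (fun i => exp (t * w i)) * diagonal w) * Nᵀ := by
        rw [hTT, mul_one]; simp only [mul_assoc]
      _ = _ := by
        rw [diagonal_mul_diagonal]; simp only [mul_comm]
  have hBS : ∀ i j, (Vᵀ * B * V) i j = S i j / b i := by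
    intro i j
    have h1 : S = diagonal b * (Vᵀ * B * V) := by
      rw [hS, ← hAB, eA]
      calc _ = (Vᵀ * V) * diagonal b * (Vᵀ * B * V) := by simp only [mul_assoc]
        _ = _ := by rw [hV, one_mul]
    rw [h1, diagonal_mul]
    have := (hb i).ne'
    field_simp
  have hSs : ∀ i j, S j i = S i j := by
    intro i j
    have : Sᵀ = S := by
      rw [hS, hA1]; simp [transpose_mul, mul_assoc]
    exact congrFun (congrFun this i) j
  have hLt : Vᵀ * mfun (crv N w t) log * V = diagonal (log ∘ b) := by
    rw [fA]
    calc _ = (Vᵀ * V) * diagonal (log ∘ b) * (Vᵀ * V) := by simp only [mul_assoc]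
      _ = _ := by rw [hV, one_mul, mul_one]
  have hG1t : G1 N w t = 2 * ∑ i, log (b i) * (S i i / b i) := by
    rw [G1, trace_conj_mul hV', hLt]
    congr 1
    apply Finset.sum_congr rfl; intro i _
    rw [Finset.sum_eq_single i]
    · rw [diagonal_apply_eq, hBS]; rfl
    · intro j _ hj; rw [diagonal_apply_ne _ hj.symm, zero_mul]
    · simp
  have hG0t : G0 N w t = ∑ i, log (b i) ^ 2 := sum_eigs (hpd t).1 log
  have hw : ∑ i, w i ^ 2 = ∑ i, ∑ j, S i j ^ 2 / (b i * b j) := by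
    have h1 : (B * B).trace = ∑ i, w i ^ 2 := by
      have : B * B = N⁻¹ᵀ * (diagonal (fun i => w i ^ 2) * Nᵀ) := by
        rw [hB]
        calc _ = N⁻¹ᵀ * diagonal w * (Nᵀ * N⁻¹ᵀ) * diagonal w * Nᵀ := by simp only [mul_assoc]
          _ = N⁻¹ᵀ * ((diagonal w * diagonal w) * Nᵀ) := by
            rw [hTT, mul_one]; simp only [mul_assoc]
          _ = _ := by rw [diagonal_mul_diagonal]; simp only [sq]
      rw [this, trace_mul_comm, mul_assoc, hTT, mul_one, trace_diagonal]
    rw [← h1, trace_conj_mul hV']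
    apply Finset.sum_congr rfl; intro i _
    apply Finset.sum_congr rfl; intro j _
    rw [hBS, hBS, hSs i j]
    have := (hb i).ne'
    have := (hb j).ne'
    field_simp
  refine ⟨?_, 2 * ∑ i, ∑ j, fd (b i) (b j) * S i j * (S j i / b j), ?_, ?_, ?_⟩
  · have e0 : G0 N w = fun s => ∑ i, ∑ j, (Vᵀ * mfun (crv N w s) log * V) i j ^ 2 := by
      ext s
      rw [sum_sq_conj hV' hV', sum_sq_eq_trace, G0]
      have := mfun_isHermitian (hpd s).1 log
      rw [IsHermitian, conjTranspose_eq_transpose_of_trivial] at this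
      rw [this]
    rw [e0]
    have h1 : HasDerivAt (fun s => ∑ i, ∑ j, (Vᵀ * mfun (crv N w s) log * V) i j ^ 2)
        (∑ i, ∑ j, (2 : ℕ) * (Vᵀ * mfun (crv N w t) log * V) i j ^ (2 - 1)
          * (fd (b i) (b j) * S i j)) t := by
      apply HasDerivAt.fun_sum; intro i _
      apply HasDerivAt.fun_sum; intro j _
      exact (hL i j).fun_pow 2
    refine h1.congr_deriv ?_
    rw [hG1t, Finset.mul_sum, hLt]
    apply Finset.sum_congr rfl; intro i _
    rw [Finset.sum_eq_single i]
    · rw [diagonal_apply_eq, fd, if_pos rfl]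
      simp; ring
    · intro j _ hj; rw [diagonal_apply_ne _ hj.symm]; simp
    · simp
  · have e1 : G1 N w = fun s => 2 * ∑ i, ∑ j,
        (Vᵀ * mfun (crv N w s) log * V) i j * (S j i / b j) := by
      ext s
      rw [G1, trace_conj_mul hV']
      simp only [hB] at hBS
      simp only [hBS]
    rw [e1]
    apply HasDerivAt.const_mul
    apply HasDerivAt.fun_sum; intro i _
    apply HasDerivAt.fun_sum; intro j _
    exact (hL i j).mul_const _
  all_goals
    have hsym : ∑ i, ∑ j, fd (b i) (b j) * S i j * (S j i / b j)
        = ∑ i, ∑ j, ((b i + b j) / 2 * fd (b i) (b j)) * (S i j ^ 2 / (b i * b j)) := by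
      have hfd : ∀ x y, fd x y = fd y x := by
        intro x y
        unfold fd
        by_cases h : x = y
        · rw [if_pos h, if_pos h.symm, h]
        · rw [if_neg h, if_neg (Ne.symm h), ← neg_sub (log y), ← neg_sub y, neg_div_neg_eq]
      have hsw : ∑ i, ∑ j, fd (b i) (b j) * S i j * (S j i / b j)
          = ∑ i, ∑ j, fd (b i) (b j) * S i j * (S j i / b i) := by
        rw [Finset.sum_comm]
        apply Finset.sum_congr rfl; intro i _
        apply Finset.sum_congr rfl; intro j _
        rw [hfd (b j), hSs i j]
      have h2 : ∑ i, ∑ j, fd (b i) (b j) * S i j * (S j i / b j)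
          = ∑ i, ∑ j, (fd (b i) (b j) * S i j * (S j i / b j)
            + fd (b i) (b j) * S i j * (S j i / b i)) / 2 := by
        simp only [add_div, Finset.sum_add_distrib, ← Finset.sum_div]
        rw [← hsw]; ring
      rw [h2]
      apply Finset.sum_congr rfl; intro i _
      apply Finset.sum_congr rfl; intro j _
      rw [hSs i j]
      have := (hb i).ne'
      have := (hb j).ne'
      field_simp
    rw [mul_div_cancel_left₀ _ (two_ne_zero), hsym, hw]
    have hp : ∀ i j, 0 ≤ S i j ^ 2 / (b i * b j) := fun i j =>
      div_nonneg (sq_nonneg _) (mul_pos (hb i) (hb j)).le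
  · apply Finset.sum_le_sum; intro i _
    apply Finset.sum_le_sum; intro j _
    have := mul_le_mul_of_nonneg_right (one_le_chi (hb i) (hb j)) (hp i j)
    linarith
  · intro e he hGe
    rw [hG0t] at hGe
    have hX := one_le_xcoth (mul_pos khat_pos he)
    set X := xcoth (khat * e)
    have h1 : ∀ i j, ((b i + b j) / 2 * fd (b i) (b j)) * (S i j ^ 2 / (b i * b j))
        ≤ X * (S i j ^ 2 / (b i * b j))
          - (X - 1) * (if i = j then S i i ^ 2 / (b i * b i) else 0) := by
      intro i j
      by_cases hij : i = j
      · subst hij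
        rw [chi_eq_one (hb i), if_pos rfl]; linarith
      · rw [if_neg hij, mul_zero, sub_zero]
        apply mul_le_mul_of_nonneg_right _ (hp i j)
        apply chi_le (hb i) (hb j) he
        refine le_trans ?_ hGe
        have := Finset.add_le_sum (f := fun i => log (b i) ^ 2) (s := Finset.univ)
          (fun i _ => sq_nonneg _) (Finset.mem_univ i) (Finset.mem_univ j) hij
        exact this
    have hCS : (G1 N w t / 2) ^ 2 ≤ e ^ 2 * ∑ i, S i i ^ 2 / (b i * b i) := by
      rw [hG1t, mul_div_cancel_left₀ _ (two_ne_zero)]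
      have := Finset.sum_mul_sq_le_sq_mul_sq Finset.univ (fun i => log (b i))
        (fun i => S i i / b i)
      refine le_trans this ?_
      have e1 : ∑ i, (S i i / b i) ^ 2 = ∑ i, S i i ^ 2 / (b i * b i) := by
        apply Finset.sum_congr rfl; intro i _
        rw [div_pow, sq (b i)]
      rw [e1]
      apply mul_le_mul_of_nonneg_right hGe
      exact Finset.sum_nonneg fun i _ => hp i i
    calc _ ≤ ∑ i, ∑ j, (X * (S i j ^ 2 / (b i * b j))
          - (X - 1) * (if i = j then S i i ^ 2 / (b i * b i) else 0)) :=
          Finset.sum_le_sum fun i _ => Finset.sum_le_sum fun j _ => h1 i j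
      _ = X * ∑ i, ∑ j, S i j ^ 2 / (b i * b j) - (X - 1) * ∑ i, S i i ^ 2 / (b i * b i) := by
          simp only [Finset.sum_sub_distrib, ← Finset.mul_sum, Finset.sum_ite_eq,
            Finset.mem_univ, if_true]
      _ ≤ _ := by
          have : (G1 N w t / 2) ^ 2 / e ^ 2 ≤ ∑ i, S i i ^ 2 / (b i * b i) := by
            rw [div_le_iff₀ (by positivity)]; linarith
          have := mul_le_mul_of_nonneg_left this (by linarith : 0 ≤ X - 1)
          linarith

lemma G0_nonneg (N : Matrix (Fin n) (Fin n) ℝ) (w : Fin n → ℝ) (s : ℝ) : 0 ≤ G0 N w s := by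
  unfold G0
  rw [sum_eigs (by unfold crv; exact diag_isHermitian _ _)]
  positivity

lemma hinge_scalar {N : Matrix (Fin n) (Fin n) ℝ} (hN : IsUnit N) {w : Fin n → ℝ}
    (hw : ∑ i, w i ^ 2 = 1) {D : ℝ} (hD : 0 < D) (h0 : G0 N w 0 ≤ D ^ 2) {T : ℝ} (hT : 0 ≤ T) :
    G0 N w T ≤ G0 N w 0 + xcoth (khat * D) / khat * (T * sinh (khat * T))
      + G1 N w 0 * (sinh (khat * T) / khat) := by
  have key : ∀ E, D < E → G0 N w T ≤ G0 N w 0 + xcoth (khat * E) / khat * (T * sinh (khat * T))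
      + G1 N w 0 * (sinh (khat * T) / khat) := by
    intro E hE
    choose g2 hg2 hlow hup using fun t => (core hN w t).2
    have hc : 0 < E ^ 2 - G0 N w 0 := by nlinarith
    set c := E ^ 2 - G0 N w 0 with hcdef
    have hpos : ∀ t, 0 < G0 N w t + c := fun t => add_pos_of_nonneg_of_pos (G0_nonneg _ _ _) hc
    have := scalar_comp (y := fun t => G0 N w t + c) (y1 := G1 N w) (y2 := g2) khat_pos
      (fun t => (core hN w t).1.add_const c) hg2 hpos
      (fun t => by
        have := hup t (√(G0 N w t + c)) (Real.sqrt_pos.2 (hpos t))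
          (by rw [Real.sq_sqrt (hpos t).le]; linarith)
        rw [Real.sq_sqrt (hpos t).le, hw, mul_one] at this
        exact this) hT
    have e : √(G0 N w 0 + c) = E := by
      rw [hcdef]
      rw [show G0 N w 0 + (E ^ 2 - G0 N w 0) = E ^ 2 by ring, Real.sqrt_sq (by linarith)]
    simp only [e] at this
    linarith
  have hcont : ContinuousAt (fun E => G0 N w 0 + xcoth (khat * E) / khat * (T * sinh (khat * T))
      + G1 N w 0 * (sinh (khat * T) / khat)) D := by
    have : ContinuousAt (fun E => xcoth (khat * E)) D := by
      unfold xcoth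
      apply ContinuousAt.div
      · fun_prop
      · fun_prop
      · exact (Real.sinh_pos_iff.2 (mul_pos khat_pos hD)).ne'
    fun_prop
  refine ge_of_tendsto (hcont.tendsto.mono_left (nhdsWithin_le_nhds (s := Set.Ioi D))) ?_
  filter_upwards [self_mem_nhdsWithin] with E hE using key E hE

lemma proj_scalar {N : Matrix (Fin n) (Fin n) ℝ} (hN : IsUnit N) {w : Fin n → ℝ}
    (hmin : ∀ θ ∈ Set.Icc (0 : ℝ) 1, G0 N w 0 ≤ G0 N w θ) : ∑ i, w i ^ 2 ≤ G0 N w 1 := by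
  choose g2 hg2 hlow hup using fun t => (core hN w t).2
  have hd := fun t => (core hN w t).1
  set ω := ∑ i, w i ^ 2 with hω
  have h1 : 0 ≤ G1 N w 0 := by
    have := (hasDerivAt_iff_tendsto_slope.1 (hd 0)).mono_left
      (nhdsWithin_mono (0 : ℝ) (fun x (hx : x ∈ Set.Ioi (0 : ℝ)) => ne_of_gt hx))
    refine ge_of_tendsto this ?_
    filter_upwards [Ioo_mem_nhdsGT (zero_lt_one' ℝ)] with x hx
    rw [slope_def_field]
    exact div_nonneg (sub_nonneg.2 (hmin x ⟨hx.1.le, hx.2.le⟩)) (by linarith [hx.1])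
  have h2 : ∀ s, 0 ≤ s → 2 * ω * s ≤ G1 N w s := by
    intro s hs
    have hm : Monotone (fun s => G1 N w s - 2 * ω * s) := by
      apply monotone_of_deriv_nonneg
      · intro x; exact ((hg2 x).sub ((hasDerivAt_id x).const_mul (2 * ω))).differentiableAt
      · intro x
        have hx : HasDerivAt (fun s => G1 N w s - 2 * ω * s) (g2 x - 2 * ω * 1) x :=
          (hg2 x).sub ((hasDerivAt_id x).const_mul (2 * ω))
        rw [hx.deriv]
        linarith [hlow x]
    have := hm hs
    simp only at this
    linarith
  have h3 : MonotoneOn (fun s => G0 N w s - ω * s ^ 2) (Set.Icc 0 1) := by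
    have hder : ∀ x, HasDerivAt (fun s => G0 N w s - ω * s ^ 2) (G1 N w x - 2 * ω * x) x := by
      intro x
      have := (hd x).sub (((hasDerivAt_id x).pow 2).const_mul ω)
      refine (this.congr_deriv ?_)
      simp; ring
    apply monotoneOn_of_deriv_nonneg (convex_Icc 0 1)
    · intro x _; exact (hder x).continuousAt.continuousWithinAt
    · intro x _; exact (hder x).differentiableAt.differentiableWithinAt
    · intro x hx
      rw [interior_Icc] at hx
      rw [(hder x).deriv]
      linarith [h2 x hx.1.le]
  have := h3 (Set.left_mem_Icc.2 zero_le_one) (Set.right_mem_Icc.2 zero_le_one) zero_le_one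
  simp only at this
  have := G0_nonneg N w 0
  linarith

lemma herm_iff {A : Matrix (Fin n) (Fin n) ℝ} : A.IsHermitian ↔ Aᵀ = A := by
  unfold IsHermitian; rw [conjTranspose_eq_transpose_of_trivial]

lemma msqrt_facts {p : Matrix (Fin n) (Fin n) ℝ} (hp : p.PosDef) :
    (msqrt p)ᵀ = msqrt p ∧ (msqrt p)⁻¹ᵀ = (msqrt p)⁻¹ ∧ msqrt p * msqrt p = p ∧
      msqrt p * (msqrt p)⁻¹ = 1 ∧ (msqrt p)⁻¹ * msqrt p = 1 ∧
      (msqrt p)⁻¹ * (msqrt p)⁻¹ = p⁻¹ ∧ IsUnit (msqrt p) := by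
  have h1 : (msqrt p)ᵀ = msqrt p := herm_iff.1 (mfun_isHermitian hp.1 _)
  have h2 : msqrt p * msqrt p = p := by
    obtain ⟨U, hU, hU', eA, fA⟩ := mfun_diag_exists hp.1
    unfold msqrt
    rw [fA, diag_conj_mul hU]
    conv_rhs => rw [eA]
    congr 3
    ext i
    exact Real.mul_self_sqrt (eigs_pos hp i).le
  have hu : IsUnit (msqrt p).det := by
    have : IsUnit p.det := (hp.det_pos).ne'.isUnit
    rw [← h2, det_mul] at this
    exact isUnit_of_mul_isUnit_left this
  refine ⟨h1, by rw [transpose_nonsing_inv, h1], h2, mul_nonsing_inv _ hu, nonsing_inv_mul _ hu,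
    ?_, (isUnit_iff_isUnit_det _).2 hu⟩
  rw [← Matrix.mul_inv_rev, h2]

lemma congr_posDef {q h : Matrix (Fin n) (Fin n) ℝ} (hq : q.PosDef) (hh : IsUnit h)
    (hs : hᵀ = h) : (h * q * h).PosDef := by
  have := (Matrix.IsUnit.posDef_star_right_conjugate_iff hh).2 hq
  rwa [star_eq_conjTranspose, conjTranspose_eq_transpose_of_trivial, hs] at this

lemma isUnit_inv {h : Matrix (Fin n) (Fin n) ℝ} (hh : IsUnit h) : IsUnit h⁻¹ := by
  rw [isUnit_iff_isUnit_det] at hh ⊢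
  exact isUnit_nonsing_inv_det _ hh

lemma S_posDef {p q : Matrix (Fin n) (Fin n) ℝ} (hp : p.PosDef) (hq : q.PosDef) :
    ((msqrt p)⁻¹ * q * (msqrt p)⁻¹).PosDef := by
  obtain ⟨h1, h2, h3, h4, h5, h6, h7⟩ := msqrt_facts hp
  exact congr_posDef hq (isUnit_inv h7) h2

lemma dR_sq {p q : Matrix (Fin n) (Fin n) ℝ} (hp : p.PosDef) (hq : q.PosDef) :
    dR p q ^ 2 = (mfun ((msqrt p)⁻¹ * q * (msqrt p)⁻¹) log *
      mfun ((msqrt p)⁻¹ * q * (msqrt p)⁻¹) log).trace := by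
  rw [sum_eigs (S_posDef hp hq).1]
  unfold dR
  rw [Real.sq_sqrt (by positivity)]

lemma mlog_inv {S : Matrix (Fin n) (Fin n) ℝ} (hS : S.PosDef) :
    mfun S⁻¹ log = - mfun S log := by
  obtain ⟨U, hU, hU', eA, fA⟩ := mfun_diag_exists hS.1
  rw [fA]
  conv_lhs => rw [eA]
  rw [diag_conj_inv hU (fun i => (eigs_pos hS i).ne'), mfun_of_diag hU]
  have : (log ∘ fun i => (eigs S i)⁻¹) = - (log ∘ eigs S) := by
    ext i; simp [Real.log_inv]
  have h2 : diagonal (-(log ∘ eigs S)) = - diagonal (log ∘ eigs S) := (diagonal_neg _).symm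
  rw [this, h2, mul_neg, neg_mul]

/-- The matrix `M = q^{-1/2} p^{1/2}`. -/
lemma M_facts {p q : Matrix (Fin n) (Fin n) ℝ} (hp : p.PosDef) (hq : q.PosDef) :
    ∃ M : Matrix (Fin n) (Fin n) ℝ, M = (msqrt q)⁻¹ * msqrt p ∧ IsUnit M ∧
      M * Mᵀ = (msqrt q)⁻¹ * p * (msqrt q)⁻¹ ∧
      mfun ((msqrt p)⁻¹ * q * (msqrt p)⁻¹) log * Mᵀ = - (Mᵀ * mfun (M * Mᵀ) log) := by
  obtain ⟨h1, h2, h3, h4, h5, h6, h7⟩ := msqrt_facts hp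
  obtain ⟨k1, k2, k3, k4, k5, k6, k7⟩ := msqrt_facts hq
  refine ⟨_, rfl, (isUnit_inv k7).mul h7, ?_, ?_⟩
  · rw [transpose_mul, h1, k2]
    conv_rhs => rw [← h3]
    simp only [mul_assoc]
  · set M := (msqrt q)⁻¹ * msqrt p with hM
    have hS := S_posDef hp hq
    have e : Mᵀ * M = ((msqrt p)⁻¹ * q * (msqrt p)⁻¹)⁻¹ := by
      symm
      apply inv_eq_right_inv
      rw [hM, transpose_mul, h1, k2]
      calc _ = (msqrt p)⁻¹ * q * ((msqrt p)⁻¹ * msqrt p) * ((msqrt q)⁻¹ * (msqrt q)⁻¹) * msqrt p := by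
            simp only [mul_assoc]
        _ = (msqrt p)⁻¹ * (q * q⁻¹) * msqrt p := by rw [h5, k6, mul_one]; simp only [mul_assoc]
        _ = 1 := by rw [mul_nonsing_inv _ hq.det_pos.ne'.isUnit, mul_one, h5]
    have : mfun (Mᵀ * M) log * Mᵀ = Mᵀ * mfun (M * Mᵀ) log := by
      apply mfun_intertwine
      · rw [herm_iff]; simp
      · rw [herm_iff]; simp
      · simp only [mul_assoc]
    rw [← this, e, mlog_inv hS, neg_mul, neg_neg]

lemma dR_symm_sq {p q : Matrix (Fin n) (Fin n) ℝ} (hp : p.PosDef) (hq : q.PosDef) :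
    dR p q ^ 2 = dR q p ^ 2 := by
  obtain ⟨M, hM, hMu, hMM, hL⟩ := M_facts hp hq
  rw [dR_sq hp hq, dR_sq hq hp, ← hMM]
  set L := mfun ((msqrt p)⁻¹ * q * (msqrt p)⁻¹) log
  have hd : IsUnit (Mᵀ).det := by
    rw [det_transpose]; exact (isUnit_iff_isUnit_det _).1 hMu
  have h1 : Mᵀ * Mᵀ⁻¹ = 1 := mul_nonsing_inv _ hd
  have h2 : Mᵀ⁻¹ * Mᵀ = 1 := nonsing_inv_mul _ hd
  have e : L * L = Mᵀ * (mfun (M * Mᵀ) log * mfun (M * Mᵀ) log) * Mᵀ⁻¹ := by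
    calc L * L = L * (L * Mᵀ) * Mᵀ⁻¹ := by simp only [mul_assoc]; rw [h1, mul_one]
      _ = -(L * Mᵀ) * mfun (M * Mᵀ) log * Mᵀ⁻¹ := by
        rw [hL]; simp only [mul_neg, neg_mul, neg_neg, ← mul_assoc, hL]
      _ = _ := by rw [hL]; simp only [neg_neg, mul_assoc]
  rw [e, trace_mul_comm, ← mul_assoc, h2, one_mul]

lemma geodesic {p q O : Matrix (Fin n) (Fin n) ℝ} (hp : p.PosDef) (hq : q.PosDef)
    (hO : Oᵀ * O = 1) (w : Fin n → ℝ) :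
    ∃ N : Matrix (Fin n) (Fin n) ℝ, IsUnit N ∧
      (∀ s : ℝ, (msqrt p * (O * diagonal (fun i => exp (s * w i)) * Oᵀ) * msqrt p).PosDef ∧
        dR q (msqrt p * (O * diagonal (fun i => exp (s * w i)) * Oᵀ) * msqrt p) ^ 2 = G0 N w s) ∧
      G1 N w 0 = -2 * (mfun ((msqrt p)⁻¹ * q * (msqrt p)⁻¹) log * (O * diagonal w * Oᵀ)).trace := by
  obtain ⟨h1, h2, h3, h4, h5, h6, h7⟩ := msqrt_facts hp
  obtain ⟨k1, k2, k3, k4, k5, k6, k7⟩ := msqrt_facts hq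
  obtain ⟨M, hM, hMu, hMM, hL⟩ := M_facts hp hq
  have hO' : O * Oᵀ = 1 := mul_eq_one_comm.1 hO
  have hOu : IsUnit O := IsUnit.of_mul_eq_one _ hO'
  have hpd : ∀ s : ℝ,
      (msqrt p * (O * diagonal (fun i => exp (s * w i)) * Oᵀ) * msqrt p).PosDef := fun s =>
    congr_posDef (diag_conj_posDef hOu (fun _ => Real.exp_pos _)) h7 h1
  refine ⟨M * O, hMu.mul hOu, fun s => ⟨hpd s, ?_⟩, ?_⟩
  · rw [dR_sq hq (hpd s), G0]
    have : (msqrt q)⁻¹ * (msqrt p * (O * diagonal (fun i => exp (s * w i)) * Oᵀ) * msqrt p)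
        * (msqrt q)⁻¹ = crv (M * O) w s := by
      rw [crv, hM]
      simp only [transpose_mul, h1, k2, mul_assoc]
    rw [this]
  · have hd : IsUnit M.det := (isUnit_iff_isUnit_det _).1 hMu
    have hMi : M⁻¹ᵀ * Mᵀ = 1 := by rw [← transpose_mul, mul_nonsing_inv _ hd, transpose_one]
    have hMi' : Mᵀ * M⁻¹ᵀ = 1 := by rw [← transpose_mul, nonsing_inv_mul _ hd, transpose_one]
    have e0 : crv (M * O) w 0 = M * Mᵀ := by
      simp only [crv, zero_mul, Real.exp_zero, transpose_mul]
      rw [show (diagonal fun _ : Fin n => (1 : ℝ)) = 1 from diagonal_one, mul_one]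
      calc _ = M * (O * Oᵀ) * Mᵀ := by simp only [mul_assoc]
        _ = _ := by rw [hO', mul_one]
    have e1 : (M * O)⁻¹ᵀ = M⁻¹ᵀ * O := by
      rw [Matrix.mul_inv_rev, transpose_mul, inv_eq_left_inv hO, transpose_transpose]
    rw [G1, e0, e1, transpose_mul]
    set L := mfun ((msqrt p)⁻¹ * q * (msqrt p)⁻¹) log
    have e2 : (mfun (M * Mᵀ) log * (M⁻¹ᵀ * O * diagonal w * (Oᵀ * Mᵀ))).trace
        = - (L * (O * diagonal w * Oᵀ)).trace := by
      calc _ = ((mfun (M * Mᵀ) log * M⁻¹ᵀ * (O * diagonal w * Oᵀ)) * Mᵀ).trace := by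
            simp only [mul_assoc]
        _ = ((Mᵀ * mfun (M * Mᵀ) log) * M⁻¹ᵀ * (O * diagonal w * Oᵀ)).trace := by
            rw [trace_mul_comm]; simp only [mul_assoc]
        _ = _ := by
            rw [show Mᵀ * mfun (M * Mᵀ) log = - (L * Mᵀ) by rw [hL, neg_neg]]
            rw [neg_mul, mul_assoc L, hMi', mul_one, neg_mul, trace_neg]
    rw [e2]; ring

lemma minner_eq {p : Matrix (Fin n) (Fin n) ℝ} (hp : p.PosDef) (u v : Matrix (Fin n) (Fin n) ℝ) :
    minner p u v = (((msqrt p)⁻¹ * u * (msqrt p)⁻¹) * ((msqrt p)⁻¹ * v * (msqrt p)⁻¹)).trace := by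
  obtain ⟨h1, h2, h3, h4, h5, h6, h7⟩ := msqrt_facts hp
  rw [minner, ← h6]
  calc _ = ((msqrt p)⁻¹ * ((msqrt p)⁻¹ * u * (msqrt p)⁻¹ * (msqrt p)⁻¹ * v)).trace := by
        simp only [mul_assoc]
    _ = _ := by rw [trace_mul_comm]; simp only [mul_assoc]

lemma tilde_log {p : Matrix (Fin n) (Fin n) ℝ} (hp : p.PosDef) (q : Matrix (Fin n) (Fin n) ℝ) :
    (msqrt p)⁻¹ * mlogP p q * (msqrt p)⁻¹ = mfun ((msqrt p)⁻¹ * q * (msqrt p)⁻¹) log := by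
  obtain ⟨h1, h2, h3, h4, h5, h6, h7⟩ := msqrt_facts hp
  rw [mlogP]
  calc _ = ((msqrt p)⁻¹ * msqrt p) * mfun ((msqrt p)⁻¹ * q * (msqrt p)⁻¹) log
        * (msqrt p * (msqrt p)⁻¹) := by simp only [mul_assoc]
    _ = _ := by rw [h4, h5, one_mul, mul_one]

lemma tilde_symm {p v : Matrix (Fin n) (Fin n) ℝ} (hp : p.PosDef) (hv : v.IsHermitian) :
    ((msqrt p)⁻¹ * v * (msqrt p)⁻¹).IsHermitian := by
  obtain ⟨h1, h2, h3, h4, h5, h6, h7⟩ := msqrt_facts hp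
  rw [herm_iff] at hv ⊢
  rw [transpose_mul, transpose_mul, h2, hv, mul_assoc]

lemma trace_cs {A B : Matrix (Fin n) (Fin n) ℝ} (hA : A.IsHermitian) (hB : B.IsHermitian) :
    (A * B).trace ≤ √((A * A).trace) * √((B * B).trace) := by
  have h : ∀ P Q : Matrix (Fin n) (Fin n) ℝ, Q.IsHermitian →
      (P * Q).trace = ∑ x ∈ (Finset.univ : Finset (Fin n × Fin n)), P x.1 x.2 * Q x.1 x.2 := by
    intro P Q hQ
    rw [herm_iff] at hQ
    rw [← Finset.univ_product_univ, Finset.sum_product]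
    simp only [trace, diag_apply, mul_apply]
    refine Finset.sum_congr rfl fun i _ => Finset.sum_congr rfl fun j _ => ?_
    conv_lhs => rw [← hQ]
    rfl
  rw [h A B hB, h A A hA, h B B hB]
  simp only [← sq]
  exact Real.sum_mul_le_sqrt_mul_sqrt _ _ _

lemma minner_log_le {p q u : Matrix (Fin n) (Fin n) ℝ} (hp : p.PosDef) (hq : q.PosDef)
    (hu : u.IsHermitian) : minner p u (mlogP p q) ≤ mnorm p u * dR p q := by
  rw [mnorm, minner_eq hp, minner_eq hp, tilde_log hp]
  have : dR p q = √(dR p q ^ 2) := (Real.sqrt_sq (Real.sqrt_nonneg _)).symm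
  rw [this, dR_sq hp hq]
  exact trace_cs (tilde_symm hp hu) (mfun_isHermitian (S_posDef hp hq).1 _)

lemma minner_pos {p v : Matrix (Fin n) (Fin n) ℝ} (hp : p.PosDef) (hv : v.IsHermitian)
    (hv0 : v ≠ 0) : 0 < minner p v v := by
  obtain ⟨h1, h2, h3, h4, h5, h6, h7⟩ := msqrt_facts hp
  have hs := herm_iff.1 (tilde_symm hp hv)
  rw [minner_eq hp]
  set V := (msqrt p)⁻¹ * v * (msqrt p)⁻¹ with hV
  have hVV : (V * V).trace = ∑ k, ∑ l, V k l ^ 2 := by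
    rw [sum_sq_eq_trace, hs]
  have hne : V ≠ 0 := by
    intro h0
    apply hv0
    calc v = (msqrt p * (msqrt p)⁻¹) * v * ((msqrt p)⁻¹ * msqrt p) := by
          rw [h4, h5, one_mul, mul_one]
      _ = msqrt p * V * msqrt p := by rw [hV]; simp only [mul_assoc]
      _ = 0 := by rw [h0]; simp
  rw [hVV]
  obtain ⟨i, j, hij⟩ : ∃ i j, V i j ≠ 0 := by
    by_contra! hh
    exact hne (by ext i j; exact hh i j)
  refine lt_of_lt_of_le (pow_pos (abs_pos.2 hij) 2) ?_
  rw [sq_abs]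
  refine le_trans ?_ (Finset.single_le_sum (f := fun k => ∑ l, V k l ^ 2)
    (fun k _ => by positivity) (Finset.mem_univ i))
  exact Finset.single_le_sum (f := fun l => V i l ^ 2) (fun k _ => by positivity)
    (Finset.mem_univ j)

lemma gd_step {p q v : Matrix (Fin n) (Fin n) ℝ} (hp : p.PosDef) (hq : q.PosDef)
    (hv : v.IsHermitian) (hv0 : v ≠ 0) {D T : ℝ} (hD : 0 < D) (hdD : dR p q ≤ D) (hT : 0 ≤ T) :
    (mexpP p (-(T / mnorm p v) • v)).PosDef ∧
    dR (mexpP p (-(T / mnorm p v) • v)) q ^ 2 ≤ dR p q ^ 2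
      + xcoth (khat * D) / khat * (T * sinh (khat * T))
      + 2 * (sinh (khat * T) / khat) * (minner p v (mlogP p q) / mnorm p v) := by
  obtain ⟨h1, h2, h3, h4, h5, h6, h7⟩ := msqrt_facts hp
  have hmp := minner_pos hp hv hv0
  have hm : 0 < mnorm p v := Real.sqrt_pos.2 hmp
  have hm2 : mnorm p v ^ 2 = minner p v v := Real.sq_sqrt hmp.le
  set m := mnorm p v with hmdef
  set V := (msqrt p)⁻¹ * v * (msqrt p)⁻¹ with hV
  have hVh : V.IsHermitian := tilde_symm hp hv
  obtain ⟨O, hO, hO', eV, -⟩ := mfun_diag_exists hVh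
  set w : Fin n → ℝ := fun i => -(eigs V i / m) with hw
  have eW : ∀ c : ℝ, O * diagonal (fun i => c * w i) * Oᵀ = (-(c / m)) • V := by
    intro c
    have : diagonal (fun i => c * w i) = (-(c / m)) • diagonal (eigs V) := by
      rw [← diagonal_smul]
      congr 1
      ext i
      simp only [hw, Pi.smul_apply, smul_eq_mul]
      ring
    rw [this, Matrix.mul_smul, Matrix.smul_mul, ← eV]
  have eW1 : O * diagonal w * Oᵀ = (-(1 / m)) • V := by
    have := eW 1
    simpa only [one_mul] using this
  have hω : ∑ i, w i ^ 2 = 1 := by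
    have e1 : ∑ i, w i ^ 2 = ((O * diagonal w * Oᵀ) * (O * diagonal w * Oᵀ)).trace := by
      rw [diag_conj_mul hO, trace_diag_conj hO]
      simp only [sq]
    rw [e1, eW1, Matrix.smul_mul, Matrix.mul_smul, trace_smul, trace_smul]
    rw [minner_eq hp, ← hV] at hm2
    rw [← hm2]
    simp only [smul_eq_mul]
    field_simp
  obtain ⟨N, hN, hG, hG1⟩ := geodesic hp hq hO w
  have eE : mexpP p (-(T / m) • v)
      = msqrt p * (O * diagonal (fun i => exp (T * w i)) * Oᵀ) * msqrt p := by
    rw [mexpP, Matrix.mul_smul, Matrix.smul_mul, ← hV, ← eW T, mfun_of_diag hO]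
    rfl
  have e0 : msqrt p * (O * diagonal (fun i => exp (0 * w i)) * Oᵀ) * msqrt p = p := by
    simp only [zero_mul, Real.exp_zero]
    rw [show (diagonal fun _ : Fin n => (1 : ℝ)) = 1 from diagonal_one, mul_one, hO', mul_one, h3]
  have g0 : G0 N w 0 = dR p q ^ 2 := by
    rw [← (hG 0).2, e0, dR_symm_sq hq hp]
  rw [eE]
  refine ⟨(hG T).1, ?_⟩
  rw [dR_symm_sq (hG T).1 hq, (hG T).2]
  have := hinge_scalar hN hω hD (by
    rw [g0]; exact pow_le_pow_left₀ (Real.sqrt_nonneg _) hdD 2) hT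
  refine this.trans (le_of_eq ?_)
  rw [g0, hG1, eW1, minner_eq hp, tilde_log hp, ← hV, Matrix.mul_smul, trace_smul,
    trace_mul_comm V]
  simp only [smul_eq_mul]
  field_simp

lemma proj_step {x P q : Matrix (Fin n) (Fin n) ℝ} (hx : x.PosDef) (hP : P.PosDef) (hq : q.PosDef)
    (hmin : ∀ θ ∈ Set.Icc (0 : ℝ) 1, dR x P ≤ dR x (gmean θ P q)) :
    dR P q ^ 2 ≤ dR x q ^ 2 := by
  obtain ⟨h1, h2, h3, h4, h5, h6, h7⟩ := msqrt_facts hP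
  have hS := S_posDef hP hq
  set S := (msqrt P)⁻¹ * q * (msqrt P)⁻¹ with hSdef
  obtain ⟨O, hO, hO', eS, fS⟩ := mfun_diag_exists hS.1
  obtain ⟨N, hN, hG, -⟩ := geodesic hP hx hO (fun i => log (eigs S i))
  have eg : ∀ θ : ℝ, gmean θ P q
      = msqrt P * (O * diagonal (fun i => exp (θ * log (eigs S i))) * Oᵀ) * msqrt P := by
    intro θ
    rw [gmean, ← hSdef, fS]
    congr 5
    ext i
    simp only [Function.comp]
    rw [Real.rpow_def_of_pos (eigs_pos hS i), mul_comm]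
  have e0 : gmean 0 P q = P := by
    rw [gmean, ← hSdef, fS]
    have : ((fun x : ℝ => x ^ (0 : ℝ)) ∘ eigs S) = fun _ => 1 := by ext i; simp
    rw [this, show (diagonal fun _ : Fin n => (1 : ℝ)) = 1 from diagonal_one, mul_one, hO',
      mul_one, h3]
  have e1 : gmean 1 P q = q := by
    rw [gmean, ← hSdef, fS]
    have : ((fun x : ℝ => x ^ (1 : ℝ)) ∘ eigs S) = eigs S := by ext i; simp
    rw [this, ← eS, hSdef]
    calc _ = (msqrt P * (msqrt P)⁻¹) * q * ((msqrt P)⁻¹ * msqrt P) := by simp only [mul_assoc]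
      _ = q := by rw [h4, h5, one_mul, mul_one]
  have hG' : ∀ θ : ℝ, dR x (gmean θ P q) ^ 2 = G0 N (fun i => log (eigs S i)) θ := by
    intro θ; rw [eg θ, (hG θ).2]
  have := proj_scalar hN (w := fun i => log (eigs S i)) (fun θ hθ => by
    rw [← hG', ← hG', e0]
    exact pow_le_pow_left₀ (Real.sqrt_nonneg _) (hmin θ hθ) 2)
  rw [← hG', e1] at this
  rw [dR_sq hP hq, ← hSdef, sum_eigs hS.1]
  exact this

lemma zeta_bound {D σ T : ℝ} (hD : 0 < D) (hT : 0 < T) (hTσ : T ≤ σ) :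
    xcoth (khat * D) / khat * (T * sinh (khat * T))
      ≤ (D * Real.sinh (khat * σ) / (σ * Real.tanh (khat * D))) * T ^ 2 := by
  have hk := khat_pos
  have hσ : 0 < σ := lt_of_lt_of_le hT hTσ
  have hs : 0 < sinh (khat * D) := Real.sinh_pos_iff.2 (mul_pos hk hD)
  have hc : 0 < cosh (khat * D) := Real.cosh_pos _
  have h := sinh_div_mono (mul_pos hk hT) (mul_le_mul_of_nonneg_left hTσ hk.le)
  have hle : sinh (khat * T) ≤ sinh (khat * σ) / σ * T := by
    rw [div_le_iff₀ (mul_pos hk hT)] at h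
    refine h.trans (le_of_eq ?_)
    field_simp
  have e1 : xcoth (khat * D) / khat * (T * sinh (khat * T))
      = (D * cosh (khat * D) / sinh (khat * D) * T) * sinh (khat * T) := by
    rw [xcoth]; field_simp
  have e2 : (D * Real.sinh (khat * σ) / (σ * Real.tanh (khat * D))) * T ^ 2
      = (D * cosh (khat * D) / sinh (khat * D) * T) * (sinh (khat * σ) / σ * T) := by
    rw [Real.tanh_eq_sinh_div_cosh]; field_simp
  rw [e1, e2]
  exact mul_le_mul_of_nonneg_left hle (by positivity)

lemma minner_add {p : Matrix (Fin n) (Fin n) ℝ} (a b c : Matrix (Fin n) (Fin n) ℝ) :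
    minner p (a + b) c = minner p a c + minner p b c := by
  simp only [minner, mul_add, add_mul, trace_add]

end SPDAux

open SPD

/-- Basic iteration inequality for the inexact projected subgradient method
with `κ̂ = 1/√2` and `ζ = D·sinh(κ̂σ)/(σ·tanh(κ̂D))`. -/
theorem basic_iteration_inequality {n : ℕ}
    (f : Matrix (Fin n) (Fin n) ℝ → ℝ) (hf : GConvexFun f)
    (X : Set (Matrix (Fin n) (Fin n) ℝ)) (hXpos : ∀ x ∈ X, x.PosDef)
    (hXne : X.Nonempty) (hXcpt : IsCompact X) (hXconv : GConvexSet X)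
    (D : ℝ) (hD : 0 < D) (hdiam : ∀ p ∈ X, ∀ q ∈ X, dR p q ≤ D)
    (p s u : ℕ → Matrix (Fin n) (Fin n) ℝ) (t : ℕ → ℝ)
    (hit : Iter f X p s u t) (ht : ∀ k, 0 < t k)
    (σ : ℝ) (hσ : 0 < σ) (htσ : ∀ k, t k ≤ σ) :
    ∀ q ∈ X, ∀ k : ℕ,
      dR (p (k + 1)) q ^ 2
        ≤ dR (p k) q ^ 2
          + (D * Real.sinh (khat * σ) / (σ * Real.tanh (khat * D))) * t k ^ 2
          + 2 * (Real.sinh (khat * t k) / khat)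
              * ((f q - f (p k) + mnorm (p k) (u k) * D) / mnorm (p k) (s k + u k)) := by
  intro q hq k
  have hmem : ∀ k, p k ∈ X := by
    intro k
    cases k with
    | zero => exact hit.p0_mem
    | succ k => exact hit.proj_mem k
  have hp := hXpos _ (hmem k)
  have hP := hXpos _ (hmem (k + 1))
  have hqp := hXpos _ hq
  have hv : (s k + u k).IsHermitian := (hit.subgrad k).1.add (hit.u_herm k)
  obtain ⟨hx, hstep⟩ := SPDAux.gd_step hp hqp hv (hit.v_ne k) hD (hdiam _ (hmem k) _ hq) (ht k).le
  have hproj := SPDAux.proj_step hx hP hqp (fun θ hθ =>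
    hit.proj_nearest k _ (hXconv _ (hmem (k + 1)) _ hq θ hθ))
  have hz := SPDAux.zeta_bound hD (ht k) (htσ k)
  have hsub := (hit.subgrad k).2 q hqp
  have hcs := SPDAux.minner_log_le hp hqp (hit.u_herm k)
  have hcs2 : mnorm (p k) (u k) * dR (p k) q ≤ mnorm (p k) (u k) * D :=
    mul_le_mul_of_nonneg_left (hdiam _ (hmem k) _ hq) (Real.sqrt_nonneg _)
  have hin : minner (p k) (s k + u k) (mlogP (p k) q)
      ≤ f q - f (p k) + mnorm (p k) (u k) * D := by
    rw [SPDAux.minner_add]; linarith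
  have hpos : 0 ≤ 2 * (Real.sinh (khat * t k) / khat) := by
    have := SPDAux.khat_pos
    have h2 : 0 ≤ Real.sinh (khat * t k) := Real.sinh_nonneg_iff.2 (mul_pos this (ht k)).le
    positivity
  have hlast := mul_le_mul_of_nonneg_left
    (div_le_div_of_nonneg_right hin (Real.sqrt_nonneg (minner (p k) (s k + u k) (s k + u k)))) hpos
  have hlast' : 2 * (Real.sinh (khat * t k) / khat)
      * (minner (p k) (s k + u k) (mlogP (p k) q) / mnorm (p k) (s k + u k))
      ≤ 2 * (Real.sinh (khat * t k) / khat)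
      * ((f q - f (p k) + mnorm (p k) (u k) * D) / mnorm (p k) (s k + u k)) := hlast
  linarith
end
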